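/- With L_z : z = 0 the line at infinity: (1) the curves C₀ ∪ L_z : z f₀ = 0 and C₁ ∪ L_z : z f₁ = 0 are nearly free with exponents (5,6) and τ(C₀ ∪ L_z) = τ(C₁ ∪ L_z) = 74; (2) the curve C_b ∪ L_z : z f_b = 0 is free with exponents (4,6) and τ(C_b ∪ L_z) = 76; (3) the curve C₀ ∪ C_b : f₀ f_b = 0 is free with exponents (9,10) and τ(C₀ ∪ C_b) = 271, and the curve C₀ ∪ C_b ∪ L_z : z f₀ f_b = 0 is free with exponents (9,11) and τ(C₀ ∪ C_b ∪ L_z) = 301. -/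

import Mathlib

open MvPolynomial

noncomputable section

/-- `S = ℂ[x,y,z]`, with `x = X 0`, `y = X 1`, `z = X 2`. -/
abbrev S3 := MvPolynomial (Fin 3) ℂ

/-- The graded `S`-module `D_0(f)` of Jacobian syzygies of `f`. -/
def jacSyz (f : S3) : Submodule S3 (Fin 3 → S3) where
  carrier := {v | v 0 * pderiv 0 f + v 1 * pderiv 1 f + v 2 * pderiv 2 f = 0}
  add_mem' := by
    intro a b ha hb
    simp only [Set.mem_setOf_eq, Pi.add_apply] at *
    linear_combination ha + hb
  zero_mem' := by simp
  smul_mem' := by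
    intro c v hv
    simp only [Set.mem_setOf_eq, Pi.smul_apply, smul_eq_mul] at *
    linear_combination c * hv

/-- `v` is a minimal system of `m` homogeneous generators of `D_0(f)`, the generator
`v j` being a syzygy of degree `dd j`, and `dd` nondecreasing: this says that
`C : f = 0` is an `m`-syzygy curve with exponents `dd`. -/
structure IsMinGenSyz (f : S3) (m : ℕ) (dd : Fin m → ℕ) (v : Fin m → (Fin 3 → S3)) : Prop where
  mem : ∀ j, v j ∈ jacSyz f
  hom : ∀ j i, ((v j) i).IsHomogeneous (dd j)
  ne_zero : ∀ j, v j ≠ 0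
  span_eq : Submodule.span S3 (Set.range v) = jacSyz f
  minimal : ∀ j, v j ∉ Submodule.span S3 (v '' {j' | j' ≠ j})
  mono : Monotone dd

/-- `C : f = 0` is free with exponents `(d1, d2)`. -/
def IsFreeWith (f : S3) (d1 d2 : ℕ) : Prop := ∃ v, IsMinGenSyz f 2 ![d1, d2] v

/-- `C : f = 0` is a free curve (a 2-syzygy curve). -/
def IsFreeCurve (f : S3) : Prop := ∃ d1 d2, IsFreeWith f d1 d2

/-- `C : f = 0` of degree `d` is nearly free with exponents `(d1, d2)`:
a 3-syzygy curve with exponents `(d1, d2, d2)` and `d1 + d2 = d`. -/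
def IsNearlyFreeWith (f : S3) (d d1 d2 : ℕ) : Prop :=
  d1 + d2 = d ∧ ∃ v, IsMinGenSyz f 3 ![d1, d2, d2] v

/-- `C : f = 0` of degree `d` is a nearly free curve. -/
def IsNearlyFree (f : S3) (d : ℕ) : Prop := ∃ d1 d2, IsNearlyFreeWith f d d1 d2

/-- `C : f = 0` of degree `d` is plus-one generated with exponents `(d1, d2, d3)`:
a 3-syzygy curve with `d1 + d2 = d`. -/
def IsPOGWith (f : S3) (d d1 d2 d3 : ℕ) : Prop :=
  d1 + d2 = d ∧ ∃ v, IsMinGenSyz f 3 ![d1, d2, d3] v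

/-- `C : f = 0` of degree `d` is a plus-one generated curve. -/
def IsPOG (f : S3) (d : ℕ) : Prop := ∃ d1 d2 d3, IsPOGWith f d d1 d2 d3

/-- `C : f = 0` of degree `d` is minimal plus-one generated (MPOG),
with exponents `(d1, d2, d2 + 1)`. -/
def IsMPOGWith (f : S3) (d d1 d2 : ℕ) : Prop := IsPOGWith f d d1 d2 (d2 + 1)

/-- `C : f = 0` of degree `d` is an MPOG-curve. -/
def IsMPOG (f : S3) (d : ℕ) : Prop := ∃ d1 d2, IsMPOGWith f d d1 d2

/-- `r = mdr(f)`: the minimal degree of a nonzero (homogeneous) Jacobian relation for `f`. -/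
def IsMDR (f : S3) (r : ℕ) : Prop :=
  (∃ v ∈ jacSyz f, v ≠ 0 ∧ ∀ i, (v i).IsHomogeneous r) ∧
  ∀ m, m < r → ∀ v ∈ jacSyz f, (∀ i, (v i).IsHomogeneous m) → v = 0

/-- The Jacobian ideal `J_f` of `f`. -/
def jacobianIdeal (f : S3) : Ideal S3 := Ideal.span {pderiv 0 f, pderiv 1 f, pderiv 2 f}

/-- The dimension of the degree `k` graded piece of the Milnor algebra `M(f) = S/J_f`. -/
def milnorDim (f : S3) (k : ℕ) : ℕ :=
  Module.finrank ℂ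
    (↥(homogeneousSubmodule (Fin 3) ℂ k) ⧸
      (Submodule.comap (homogeneousSubmodule (Fin 3) ℂ k).subtype
        (Submodule.restrictScalars ℂ (jacobianIdeal f))))

/-- `τ` is the total Tjurina number of the reduced curve `C : f = 0`, i.e. the degree of the
Jacobian ideal `J_f`: for all large `k` one has `dim M(f)_k = τ`. -/
def IsTjurina (f : S3) (τ : ℕ) : Prop := ∀ᶠ k in Filter.atTop, milnorDim f k = τ

/-- `C : f = 0` is a maximal Tjurina curve of type `(d, r)`. -/
def IsMaxTjurina (f : S3) (d r : ℕ) : Prop :=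
  IsMDR f r ∧ d ≤ 2 * r ∧
  ∃ τ : ℕ, IsTjurina f τ ∧
    (τ : ℤ) = ((d : ℤ) - 1) ^ 2 - r * ((d : ℤ) - r - 1) - (Nat.choose (2 * r + 2 - d) 2 : ℤ)

/-- `f` is a product of `d` linear forms all vanishing at a common point, i.e.
`C : f = 0` is the union of `d` lines passing through one point. -/
def IsUnionOfConcurrentLines (f : S3) (d : ℕ) : Prop :=
  ∃ (c : ℂ) (L : Fin d → Fin 3 → ℂ) (v : Fin 3 → ℂ), v ≠ 0 ∧
    f = C c * ∏ j, (∑ i, C (L j i) * X i) ∧ ∀ j, (∑ i, L j i * v i) = 0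

/-- The ideal `I_θ` generated by the 2×2 minors of the matrix with rows `(x,y,z)` and
`(a,b,c)`, defining the eigenscheme `Γ_θ` of the derivation `θ = a ∂_x + b ∂_y + c ∂_z`. -/
def eigenIdeal (a b c : S3) : Ideal S3 :=
  Ideal.span {X 1 * c - X 2 * b, X 2 * a - X 0 * c, X 0 * b - X 1 * a}

/-- The projective plane `ℙ²(ℂ)`. -/
abbrev Pt := Projectivization ℂ (Fin 3 → ℂ)

/-- The eigenscheme `Γ_θ` of `θ = a ∂_x + b ∂_y + c ∂_z` is 0-dimensional:
its set of points in `ℙ²` is finite. -/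
def EigenSchemeFinite (a b c : S3) : Prop :=
  {p : Pt | eval p.rep (X 1 * c - X 2 * b) = 0 ∧ eval p.rep (X 2 * a - X 0 * c) = 0 ∧
      eval p.rep (X 0 * b - X 1 * a) = 0}.Finite

/-- The homogenization `f₀` of the Briançon polynomial `g`. -/
def f0 : S3 :=
  X 0 ^ 6 * X 1 ^ 4 + 4 * X 0 ^ 5 * X 1 ^ 3 * X 2 ^ 2 + 3 * X 0 ^ 4 * X 1 ^ 3 * X 2 ^ 3 +
    6 * X 0 ^ 4 * X 1 ^ 2 * X 2 ^ 4 + C (19 / 3 : ℂ) * X 0 ^ 3 * X 1 ^ 2 * X 2 ^ 5 +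
    4 * X 0 ^ 3 * X 1 * X 2 ^ 6 + 3 * X 0 ^ 2 * X 1 ^ 2 * X 2 ^ 6 +
    C (11 / 3 : ℂ) * X 0 ^ 2 * X 1 * X 2 ^ 7 + X 0 ^ 2 * X 2 ^ 8 + 2 * X 0 * X 1 * X 2 ^ 8 +
    C (1 / 3 : ℂ) * X 0 * X 2 ^ 9 + X 1 * X 2 ^ 9 - X 2 ^ 10

/-- `f_b = f₀ + (16/9) z¹⁰`. -/
def fb : S3 := f0 + C (16 / 9 : ℂ) * X 2 ^ 10

/-- `f₁ = f₀ - z¹⁰`. -/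
def f1 : S3 := f0 - X 2 ^ 10

open scoped Matrix

/-! ### Dimension counts for homogeneous pieces -/

theorem finrank_homogeneousSubmodule_fin_three (n : ℕ) :
    Module.finrank ℂ (homogeneousSubmodule (Fin 3) ℂ n) = (n + 2).choose 2 := by
  have hset : {d : Fin 3 →₀ ℕ | d.degree = n} =
      ((Finset.univ : Finset (Fin 3)).finsuppAntidiag n : Set (Fin 3 →₀ ℕ)) := by
    ext d
    simp [Finset.mem_finsuppAntidiag, Finsupp.degree_eq_sum]
  rw [homogeneousSubmodule_eq_finsupp_supported, hset,
    (AddMonoidAlgebra.supportedEquivFinsupp _).finrank_eq, Module.finrank_finsupp_self]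
  simp only [Finset.coe_sort_coe, Fintype.card_coe]
  rw [Finset.card_finsuppAntidiag_nat_eq_choose]
  simp only [Finset.card_univ, Fintype.card_fin]
  rw [show 3 + n - 1 = n + 2 by omega, ← Nat.choose_symm_add]

instance finiteDimensional_homogeneousSubmodule_fin_three (n : ℕ) :
    FiniteDimensional ℂ (homogeneousSubmodule (Fin 3) ℂ n) :=
  Module.Finite.iff_fg.mpr (homogeneousSubmodule_fg _ _ n)

theorem homogeneousComponent_mul_of_isHomogeneous {p : S3} {k : ℕ} (hp : p.IsHomogeneous k)
    (a : S3) (n : ℕ) :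
    homogeneousComponent (n + k) (a * p) = homogeneousComponent n a * p := by
  let _ := gradedAlgebra (σ := Fin 3) (R := ℂ)
  have h := DirectSum.coe_decompose_mul_of_right_mem_of_le
    (𝒜 := homogeneousSubmodule (Fin 3) ℂ) (a := a) (n := n + k) hp (Nat.le_add_left k n)
  rw [Nat.add_sub_cancel] at h
  rw [← decomposition.decompose'_apply, ← decomposition.decompose'_apply]
  exact h

/-- Rank-nullity for the restriction of a linear map to a finite-dimensional subspace. -/
theorem finrank_map_add_finrank_inf_ker {V W : Type*} [AddCommGroup V] [Module ℂ V]
    [AddCommGroup W] [Module ℂ W] (T : V →ₗ[ℂ] W) (p : Submodule ℂ V) [FiniteDimensional ℂ p] :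
    Module.finrank ℂ (p.map T) + Module.finrank ℂ ↥(p ⊓ LinearMap.ker T) =
      Module.finrank ℂ p := by
  have h := LinearMap.finrank_range_add_finrank_ker (T.domRestrict p)
  rw [LinearMap.range_domRestrict] at h
  rw [← h, LinearMap.ker_domRestrict, add_right_inj]
  have e := (Submodule.comapSubtypeEquivOfLe (p := p ⊓ LinearMap.ker T) (q := p) inf_le_left)
  rw [← e.finrank_eq, Submodule.comap_inf, Submodule.comap_subtype_self, top_inf_eq]

/-- Tuples of polynomials whose `j`-th entry is homogeneous of degree `dd j`. -/
def homTuples {m : ℕ} (dd : Fin m → ℕ) : Submodule ℂ (Fin m → S3) :=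
  Submodule.pi Set.univ fun j => homogeneousSubmodule (Fin 3) ℂ (dd j)

theorem mem_homTuples {m : ℕ} {dd : Fin m → ℕ} {a : Fin m → S3} :
    a ∈ homTuples dd ↔ ∀ j, (a j).IsHomogeneous (dd j) := by
  simp [homTuples, Submodule.mem_pi]

/-- A tuple with homogeneous entries is the same as a family of homogeneous polynomials. -/
def homTuplesEquiv {m : ℕ} (dd : Fin m → ℕ) :
    homTuples dd ≃ₗ[ℂ] ((j : Fin m) → homogeneousSubmodule (Fin 3) ℂ (dd j)) where
  toFun a j := ⟨a.1 j, mem_homTuples.mp a.2 j⟩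
  invFun b := ⟨fun j => (b j).1, mem_homTuples.mpr fun j => (b j).2⟩
  map_add' _ _ := rfl
  map_smul' _ _ := rfl
  left_inv _ := rfl
  right_inv _ := rfl

instance finiteDimensional_homTuples {m : ℕ} (dd : Fin m → ℕ) :
    FiniteDimensional ℂ (homTuples dd) :=
  (homTuplesEquiv dd).symm.finiteDimensional

theorem finrank_homTuples {m : ℕ} (dd : Fin m → ℕ) :
    Module.finrank ℂ (homTuples dd) = ∑ j, (dd j + 2).choose 2 := by
  rw [(homTuplesEquiv dd).finrank_eq, Module.finrank_pi_fintype]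
  simp only [finrank_homogeneousSubmodule_fin_three]

/-- The map `v ↦ ∑ i, v i * g i`. -/
def dotMap (g : Fin 3 → S3) : (Fin 3 → S3) →ₗ[ℂ] S3 :=
  (∑ i, (LinearMap.mulRight ℂ (g i)).comp (LinearMap.proj i))

theorem dotMap_apply (g v : Fin 3 → S3) : dotMap g v = ∑ i, v i * g i := by
  simp [dotMap]

/-- The map `a ↦ ∑ j, a j • v j`. -/
def combMap {m : ℕ} (v : Fin m → Fin 3 → S3) : (Fin m → S3) →ₗ[ℂ] (Fin 3 → S3) :=
  (Fintype.linearCombination S3 v).restrictScalars ℂ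

theorem combMap_apply {m : ℕ} (v : Fin m → Fin 3 → S3) (a : Fin m → S3) :
    combMap v a = ∑ j, a j • v j := by
  simp [combMap, Fintype.linearCombination_apply]

/-- The gradient of `f`. -/
def grad (f : S3) : Fin 3 → S3 := fun i => pderiv i f

theorem mem_jacSyz_iff {f : S3} {v : Fin 3 → S3} : v ∈ jacSyz f ↔ v ⬝ᵥ grad f = 0 := by
  simp only [dotProduct, Fin.sum_univ_three]
  rfl

theorem mem_jacSyz_iff_dotMap {f : S3} {v : Fin 3 → S3} :
    v ∈ jacSyz f ↔ v ∈ LinearMap.ker (dotMap (grad f)) := by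
  rw [mem_jacSyz_iff, LinearMap.mem_ker, dotMap_apply]
  rfl

theorem mem_jacobianIdeal_iff {f h : S3} :
    h ∈ jacobianIdeal f ↔ ∃ v : Fin 3 → S3, dotMap (grad f) v = h := by
  have : ({pderiv 0 f, pderiv 1 f, pderiv 2 f} : Set S3) = Set.range (grad f) := by
    ext p
    simp [grad, Fin.exists_fin_succ, eq_comm]
  rw [jacobianIdeal, this, Ideal.mem_span_range_iff_exists_fun]
  simp only [dotMap_apply]

/-- The degree `k` piece of the Jacobian ideal. -/
def jacobianPiece (f : S3) (k : ℕ) : Submodule ℂ S3 :=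
  homogeneousSubmodule (Fin 3) ℂ k ⊓ (jacobianIdeal f).restrictScalars ℂ

theorem map_dotMap_homTuples {f : S3} {e : ℕ} (hf : f.IsHomogeneous (e + 1)) (m : ℕ) :
    (homTuples fun _ : Fin 3 => m).map (dotMap (grad f)) =
      jacobianPiece f (m + e) := by
  have hg : ∀ i, (grad f i).IsHomogeneous e := fun i => hf.pderiv
  ext h
  simp only [jacobianPiece, Submodule.mem_map, Submodule.mem_inf, mem_homTuples,
    Submodule.restrictScalars_mem,
    mem_homogeneousSubmodule, mem_jacobianIdeal_iff]
  constructor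
  · rintro ⟨v, hv, rfl⟩
    refine ⟨?_, v, rfl⟩
    rw [dotMap_apply]
    exact IsHomogeneous.sum _ _ _ fun i _ => (hv i).mul (hg i)
  · rintro ⟨hh, v, rfl⟩
    refine ⟨fun i => homogeneousComponent m (v i),
      fun i => homogeneousComponent_isHomogeneous m (v i), ?_⟩
    rw [← homogeneousComponent_eq_self hh, dotMap_apply, dotMap_apply, map_sum]
    exact Finset.sum_congr rfl fun i _ =>
      (homogeneousComponent_mul_of_isHomogeneous (hg i) _ _).symm

theorem milnorDim_add_finrank (f : S3) (k : ℕ) :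
    milnorDim f k + Module.finrank ℂ (jacobianPiece f k) = (k + 2).choose 2 := by
  have h := Submodule.finrank_quotient_add_finrank
    (Submodule.comap (homogeneousSubmodule (Fin 3) ℂ k).subtype
      (Submodule.restrictScalars ℂ (jacobianIdeal f)))
  rw [finrank_homogeneousSubmodule_fin_three] at h
  rw [← h, milnorDim, add_right_inj, ← (Submodule.comapSubtypeEquivOfLe
    (p := jacobianPiece f k)
    (q := homogeneousSubmodule (Fin 3) ℂ k) inf_le_left).finrank_eq, jacobianPiece,
    Submodule.comap_inf,
    Submodule.comap_subtype_self, top_inf_eq]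

theorem map_combMap_homTuples {f : S3} {m : ℕ} {dd : Fin m → ℕ} {v : Fin m → Fin 3 → S3}
    (hv : IsMinGenSyz f m dd v) (n : ℕ) (hn : ∀ j, dd j ≤ n) :
    (homTuples fun j => n - dd j).map (combMap v) =
      homTuples (fun _ : Fin 3 => n) ⊓ LinearMap.ker (dotMap (grad f)) := by
  ext w
  simp only [Submodule.mem_map, Submodule.mem_inf, ← mem_jacSyz_iff_dotMap, mem_homTuples]
  constructor
  · rintro ⟨a, ha, rfl⟩
    rw [combMap_apply]
    refine ⟨fun i => ?_, Submodule.sum_mem _ fun j _ => Submodule.smul_mem _ _ (hv.mem j)⟩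
    rw [Finset.sum_apply]
    refine IsHomogeneous.sum _ _ _ fun j _ => ?_
    have := (ha j).mul (hv.hom j i)
    rwa [Nat.sub_add_cancel (hn j)] at this
  · rintro ⟨hw, hmem⟩
    rw [← hv.span_eq, Submodule.mem_span_range_iff_exists_fun] at hmem
    obtain ⟨a, rfl⟩ := hmem
    refine ⟨fun j => homogeneousComponent (n - dd j) (a j),
      fun j => homogeneousComponent_isHomogeneous _ _, ?_⟩
    rw [combMap_apply]
    funext i
    rw [← homogeneousComponent_eq_self (hw i), Finset.sum_apply, Finset.sum_apply, map_sum]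
    refine Finset.sum_congr rfl fun j _ => ?_
    have := homogeneousComponent_mul_of_isHomogeneous (hv.hom j i) (a j) (n - dd j)
    rw [Nat.sub_add_cancel (hn j)] at this
    exact this.symm

/-- The Hilbert function of the Milnor algebra in terms of a minimal system of generators of
`D_0(f)` and of the relations among these generators. -/
theorem milnorDim_add_sum {f : S3} {e m : ℕ} {dd : Fin m → ℕ} {v : Fin m → Fin 3 → S3}
    (hf : f.IsHomogeneous (e + 1)) (hv : IsMinGenSyz f m dd v) (n : ℕ) (hn : ∀ j, dd j ≤ n) :
    milnorDim f (n + e) + 3 * (n + 2).choose 2 + Module.finrank ℂ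
      ↥(homTuples (fun j => n - dd j) ⊓ LinearMap.ker (combMap v)) =
      (n + e + 2).choose 2 + ∑ j, (n - dd j + 2).choose 2 := by
  have h1 := milnorDim_add_finrank f (n + e)
  have h2 := finrank_map_add_finrank_inf_ker (dotMap (grad f)) (homTuples fun _ : Fin 3 => n)
  have h3 := finrank_map_add_finrank_inf_ker (combMap v) (homTuples fun j => n - dd j)
  rw [map_dotMap_homTuples hf, finrank_homTuples] at h2
  rw [map_combMap_homTuples hv n hn, finrank_homTuples] at h3
  simp only [Finset.sum_const, Finset.card_univ, Fintype.card_fin, smul_eq_mul] at h2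
  omega

/-! ### Vectors of polynomials and cross products -/

/-- The entries of `g` have no common zero outside `z = 0`, and no common factor `z`. -/
def IsPrimitiveAlongZ (g : Fin 3 → S3) : Prop :=
  (∃ M : ℕ, X 2 ^ M ∈ Ideal.span (Set.range g)) ∧ ∃ j, ¬ (X 2 : S3) ∣ g j

theorem IsPrimitiveAlongZ.ne_zero {g : Fin 3 → S3} (hg : IsPrimitiveAlongZ g) : g ≠ 0 := by
  obtain ⟨j, hj⟩ := hg.2
  rintro rfl
  exact hj (dvd_zero _)

theorem cross_eq_zero_iff {u p : Fin 3 → S3} :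
    u ⨯₃ p = 0 ↔ ∀ i j, u i * p j = u j * p i := by
  rw [cross_apply]
  constructor
  · intro h i j
    have h0 := congrFun h 0
    have h1 := congrFun h 1
    have h2 := congrFun h 2
    simp at h0 h1 h2
    fin_cases i <;> fin_cases j <;> simp <;> first
      | linear_combination h0 | linear_combination h1 | linear_combination h2
      | linear_combination -h0 | linear_combination -h1 | linear_combination -h2
  · intro h
    funext i
    fin_cases i <;> simp [h 1 2, h 2 0, h 0 1]

theorem IsPrimitiveAlongZ.exists_eq_smul {g u : Fin 3 → S3} (hg : IsPrimitiveAlongZ g)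
    (h : u ⨯₃ g = 0) : ∃ t : S3, u = t • g := by
  obtain ⟨⟨M, hM⟩, j, hj⟩ := hg
  rw [Ideal.mem_span_range_iff_exists_fun] at hM
  obtain ⟨a, ha⟩ := hM
  rw [cross_eq_zero_iff] at h
  have key : ∀ k, X 2 ^ M * u k = (∑ i, a i * u i) * g k := by
    intro k
    rw [← ha, Finset.sum_mul, Finset.sum_mul]
    exact Finset.sum_congr rfl fun i _ => by linear_combination a i * h k i
  obtain ⟨t, ht⟩ : X 2 ^ M ∣ ∑ i, a i * u i :=
    X_prime.pow_dvd_of_dvd_mul_right M hj ⟨u j, (key j).symm⟩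
  refine ⟨t, funext fun k => ?_⟩
  have hz : (X 2 ^ M : S3) ≠ 0 := pow_ne_zero _ (X_ne_zero 2)
  apply mul_left_cancel₀ hz
  rw [key k, ht, Pi.smul_apply, smul_eq_mul, mul_assoc]

/-- The cross product of two syzygies is a multiple of the gradient. -/
theorem exists_cross_eq_smul_grad {f : S3} (hf : IsPrimitiveAlongZ (grad f)) {w r : Fin 3 → S3}
    (hw : w ∈ jacSyz f) (hr : r ∈ jacSyz f) : ∃ t : S3, w ⨯₃ r = t • grad f := by
  apply hf.exists_eq_smul
  rw [mem_jacSyz_iff] at hw hr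
  rw [cross_cross_eq_smul_sub_smul, hw, hr, zero_smul, zero_smul, sub_zero]

theorem eq_zero_of_cross_eq_zero {u r s : Fin 3 → S3} (hrs : r ⨯₃ s ≠ 0) (hr : u ⨯₃ r = 0)
    (hs : u ⨯₃ s = 0) : u = 0 := by
  rw [cross_eq_zero_iff] at hr
  obtain ⟨k, hk⟩ := Function.ne_iff.mp hrs
  have h : ∀ i, u i • (r ⨯₃ s) = 0 := by
    intro i
    have : u i • r = r i • u := by
      funext j
      simp only [Pi.smul_apply, smul_eq_mul]
      linear_combination hr i j
    rw [← LinearMap.smul_apply, ← map_smul, this, map_smul, LinearMap.smul_apply, hs, smul_zero]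
  funext i
  have := congrFun (h i) k
  simp only [Pi.smul_apply, smul_eq_mul, Pi.zero_apply, mul_eq_zero] at this
  exact this.resolve_right hk

theorem mem_jacSyz_of_cross_left {f : S3} {r s : Fin 3 → S3} {t : S3} (ht : t ≠ 0)
    (h : r ⨯₃ s = t • grad f) : r ∈ jacSyz f := by
  have := dot_self_cross r s
  rw [h, dotProduct_smul, smul_eq_mul, mul_eq_zero] at this
  exact mem_jacSyz_iff.mpr (this.resolve_left ht)

theorem mem_jacSyz_of_cross_right {f : S3} {r s : Fin 3 → S3} {t : S3} (ht : t ≠ 0)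
    (h : r ⨯₃ s = t • grad f) : s ∈ jacSyz f := by
  have := dot_cross_self r s
  rw [h, dotProduct_smul, smul_eq_mul, mul_eq_zero] at this
  exact mem_jacSyz_iff.mpr (this.resolve_left ht)

theorem smul_grad_injective {f : S3} (hf : IsPrimitiveAlongZ (grad f)) {s t : S3}
    (h : s • grad f = t • grad f) : s = t :=
  smul_left_injective S3 hf.ne_zero h

/-! ### Free curves -/

/-- Saito's criterion. -/
theorem isMinGenSyz_of_cross {f : S3} (hf : IsPrimitiveAlongZ (grad f)) {d₁ d₂ : ℕ}
    (hd : d₁ ≤ d₂) {c : ℂ} (hc : c ≠ 0) {v₁ v₂ : Fin 3 → S3}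
    (h₁ : ∀ i, (v₁ i).IsHomogeneous d₁) (h₂ : ∀ i, (v₂ i).IsHomogeneous d₂)
    (hcross : v₁ ⨯₃ v₂ = (C c : S3) • grad f) : IsMinGenSyz f 2 ![d₁, d₂] ![v₁, v₂] := by
  have hc' : (C c : S3) ≠ 0 := by simpa using hc
  have hinv : (C c⁻¹ * C c : S3) = 1 := by rw [← C_mul, inv_mul_cancel₀ hc, C_1]
  have m₁ := mem_jacSyz_of_cross_left hc' hcross
  have m₂ := mem_jacSyz_of_cross_right hc' hcross
  have hne : v₁ ⨯₃ v₂ ≠ 0 := hcross ▸ smul_ne_zero hc' hf.ne_zero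
  have hanti : v₂ ⨯₃ v₁ = -((C c : S3) • grad f) := by rw [← hcross, cross_anticomm]
  have min₁ : v₁ ∉ Submodule.span S3 {v₂} := by
    intro h
    obtain ⟨a, rfl⟩ := Submodule.mem_span_singleton.mp h
    simp at hne
  have min₂ : v₂ ∉ Submodule.span S3 {v₁} := by
    intro h
    obtain ⟨a, rfl⟩ := Submodule.mem_span_singleton.mp h
    simp at hne
  refine ⟨?_, ?_, ?_, ?_, ?_, ?_⟩
  · simpa [Fin.forall_fin_two] using ⟨m₁, m₂⟩
  · simpa [Fin.forall_fin_two] using ⟨h₁, h₂⟩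
  · rw [Fin.forall_fin_two]
    exact ⟨fun h => min₁ (by simp_all), fun h => min₂ (by simp_all)⟩
  · apply le_antisymm
    · rw [Submodule.span_le]
      rintro _ ⟨j, rfl⟩
      fin_cases j
      exacts [m₁, m₂]
    · intro w hw
      obtain ⟨t₁, ht₁⟩ := exists_cross_eq_smul_grad hf hw m₁
      obtain ⟨t₂, ht₂⟩ := exists_cross_eq_smul_grad hf hw m₂
      have hzero : w - ((C c⁻¹ * t₂) • v₁ - (C c⁻¹ * t₁) • v₂) = 0 := by
        apply eq_zero_of_cross_eq_zero hne
        · simp only [map_sub, map_smul, LinearMap.sub_apply, LinearMap.smul_apply, cross_self,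
            ht₁, hanti]
          funext i
          simp only [Pi.sub_apply, Pi.smul_apply, Pi.neg_apply, Pi.zero_apply, smul_eq_mul]
          linear_combination -t₁ * grad f i * hinv
        · simp only [map_sub, map_smul, LinearMap.sub_apply, LinearMap.smul_apply, cross_self,
            ht₂, hcross]
          funext i
          simp only [Pi.sub_apply, Pi.smul_apply, Pi.zero_apply, smul_eq_mul]
          linear_combination -t₂ * grad f i * hinv
      rw [sub_eq_zero.mp hzero]
      exact Submodule.sub_mem _
        (Submodule.smul_mem _ _ (Submodule.subset_span ⟨0, rfl⟩))
        (Submodule.smul_mem _ _ (Submodule.subset_span ⟨1, rfl⟩))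
  · rw [Fin.forall_fin_two]
    have e₁ : {j' : Fin 2 | j' ≠ 0} = {1} := by ext j; fin_cases j <;> simp
    have e₂ : {j' : Fin 2 | j' ≠ 1} = {0} := by ext j; fin_cases j <;> simp
    rw [e₁, e₂]
    simpa using ⟨min₁, min₂⟩
  · simpa [Fin.monotone_iff_le_succ] using hd

theorem cast_choose_add_two (n : ℕ) : ((n + 2).choose 2 : ℚ) = (n + 2) * (n + 1) / 2 := by
  rw [Nat.cast_choose_two]
  push_cast
  ring

theorem isTjurina_of_cross {f : S3} (hf : IsPrimitiveAlongZ (grad f)) {e d₁ d₂ τ : ℕ}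
    (hfd : f.IsHomogeneous (e + 1)) {c : ℂ} (hc : c ≠ 0) {v₁ v₂ : Fin 3 → S3}
    (hv : IsMinGenSyz f 2 ![d₁, d₂] ![v₁, v₂])
    (hcross : v₁ ⨯₃ v₂ = (C c : S3) • grad f) (hd : d₁ + d₂ = e)
    (hτ : τ + d₁ * d₂ = e ^ 2) : IsTjurina f τ := by
  have hne : v₁ ⨯₃ v₂ ≠ 0 := hcross ▸ smul_ne_zero (by simpa using hc) hf.ne_zero
  have hker : LinearMap.ker (combMap ![v₁, v₂]) = ⊥ := by
    rw [LinearMap.ker_eq_bot']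
    intro a ha
    rw [combMap_apply, Fin.sum_univ_two] at ha
    simp only [Matrix.cons_val_zero, Matrix.cons_val_one] at ha
    have h₁ := congrArg (fun u => v₁ ⨯₃ u) ha
    have h₂ := congrArg (fun u => u ⨯₃ v₂) ha
    simp only [map_add, map_smul, LinearMap.add_apply, LinearMap.smul_apply, cross_self,
      smul_zero, zero_add, add_zero, map_zero, LinearMap.zero_apply, smul_eq_zero, hne,
      or_false] at h₁ h₂
    funext j
    fin_cases j
    exacts [h₂, h₁]
  filter_upwards [Filter.eventually_ge_atTop (d₁ + d₂ + e)] with k hk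
  obtain ⟨n, rfl⟩ := Nat.exists_eq_add_of_le hk
  have h := milnorDim_add_sum hfd hv (n + d₁ + d₂)
    (by rw [Fin.forall_fin_two]; exact ⟨by simp; omega, by simp⟩)
  rw [hker, inf_bot_eq, finrank_bot, Fin.sum_univ_two] at h
  simp only [Matrix.cons_val_zero, Matrix.cons_val_one] at h
  rw [show n + d₁ + d₂ - d₁ = n + d₂ by omega, show n + d₁ + d₂ - d₂ = n + d₁ by omega,
    show n + d₁ + d₂ + e = d₁ + d₂ + e + n by ring] at h
  have h' := congrArg (Nat.cast : ℕ → ℚ) h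
  have hτ' := congrArg (Nat.cast : ℕ → ℚ) hτ
  subst hd
  push_cast [cast_choose_add_two] at h' hτ'
  have : (milnorDim f (d₁ + d₂ + (d₁ + d₂) + n) : ℚ) = τ := by
    linear_combination h' - hτ'
  exact_mod_cast this

/-! ### Linear forms through a point of the chart `z = 1` -/

/-- The linear form `a xᵢ + b z`. -/
def linForm (i : Fin 3) (a b : ℂ) : S3 := C a * X i + C b * X 2

theorem isHomogeneous_linForm (i : Fin 3) (a b : ℂ) : (linForm i a b).IsHomogeneous 1 :=
  (isHomogeneous_C_mul_X a i).add (isHomogeneous_C_mul_X b 2)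

theorem eval_linForm (i : Fin 3) (a b : ℂ) (p : Fin 3 → ℂ) :
    eval p (linForm i a b) = a * p i + b * p 2 := by
  simp [linForm]

theorem sub_algHom_mem {I : Ideal S3} (σ : S3 →ₐ[ℂ] S3) (h : ∀ i, X i - σ (X i) ∈ I) (p : S3) :
    p - σ p ∈ I := by
  have : (Ideal.Quotient.mkₐ ℂ I).comp σ = Ideal.Quotient.mkₐ ℂ I := by
    apply MvPolynomial.algHom_ext
    intro i
    exact (Ideal.Quotient.eq.mpr (h i)).symm
  exact Ideal.Quotient.eq.mp (DFunLike.congr_fun this p).symm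

theorem X_sub_mem_of_linForm_mem {I : Ideal S3} {i : Fin 3} {a b : ℂ} (ha : a ≠ 0)
    (h : linForm i a b ∈ I) : X i - C (-b / a) * X 2 ∈ I := by
  have : X i - C (-b / a) * X 2 = C a⁻¹ * linForm i a b := by
    have h₁ : (C a⁻¹ * C a : S3) = 1 := by rw [← C_mul, inv_mul_cancel₀ ha, C_1]
    rw [linForm, show -b / a = -(a⁻¹ * b) by ring, C_neg, C_mul]
    linear_combination -X i * h₁
  rw [this]
  exact I.mul_mem_left _ h

section LinearForms

variable {a₂ b₂ a₃ b₃ : ℂ} (h₂ : a₂ ≠ 0) (h₃ : a₃ ≠ 0)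
include h₂ h₃

theorem linForm_dvd_of_mul_add_mul_eq_zero {p q : S3}
    (h : linForm 0 a₂ b₂ * p + linForm 1 a₃ b₃ * q = 0) : linForm 1 a₃ b₃ ∣ p := by
  let σ : S3 →ₐ[ℂ] S3 := aeval ![X 0, C (-b₃ / a₃) * X 2, X 2]
  have hσ : ∀ r, r - σ r ∈ Ideal.span {linForm 1 a₃ b₃} := by
    apply sub_algHom_mem
    intro i
    fin_cases i
    · simp [σ]
    · simpa [σ] using X_sub_mem_of_linForm_mem h₃ (Ideal.mem_span_singleton_self _)
    · simp [σ]
  have h0 : σ (linForm 1 a₃ b₃) = 0 := by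
    have e : a₃ * (-b₃ / a₃) = -b₃ := by field_simp
    simp only [linForm, map_add, map_mul, σ, aeval_X, algHom_C, algebraMap_eq]
    simp [← mul_assoc, ← C_mul, e]
  have hne : σ (linForm 0 a₂ b₂) ≠ 0 := by
    intro h'
    have := congrArg (eval ![1, 0, 0]) h'
    simp [linForm, σ] at this
    exact h₂ this
  have hp : σ p = 0 := by
    have := congrArg σ h
    rw [map_add, map_mul, map_mul, h0, zero_mul, add_zero, map_zero, mul_eq_zero] at this
    exact this.resolve_left hne
  have := hσ p
  rwa [hp, sub_zero, Ideal.mem_span_singleton] at this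

theorem exists_eq_linForm_comb {q p s t : S3} (hq : eval ![-b₂ / a₂, -b₃ / a₃, 1] q ≠ 0)
    (h : q * p + linForm 0 a₂ b₂ * s + linForm 1 a₃ b₃ * t = 0) :
    ∃ α β, p = linForm 0 a₂ b₂ * α + linForm 1 a₃ b₃ * β := by
  let I : Ideal S3 := Ideal.span {linForm 0 a₂ b₂, linForm 1 a₃ b₃}
  let σ : S3 →ₐ[ℂ] S3 := aeval ![C (-b₂ / a₂) * X 2, C (-b₃ / a₃) * X 2, X 2]
  have hσ : ∀ r, r - σ r ∈ I := by
    apply sub_algHom_mem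
    intro i
    fin_cases i
    · simpa [σ] using X_sub_mem_of_linForm_mem h₂ (Ideal.subset_span (by simp))
    · simpa [σ] using X_sub_mem_of_linForm_mem h₃ (Ideal.subset_span (by simp))
    · simp [σ]
  have h0 : σ (linForm 0 a₂ b₂) = 0 := by
    have e : a₂ * (-b₂ / a₂) = -b₂ := by field_simp
    simp only [linForm, map_add, map_mul, σ, aeval_X, algHom_C, algebraMap_eq]
    simp [← mul_assoc, ← C_mul, e]
  have h1 : σ (linForm 1 a₃ b₃) = 0 := by
    have e : a₃ * (-b₃ / a₃) = -b₃ := by field_simp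
    simp only [linForm, map_add, map_mul, σ, aeval_X, algHom_C, algebraMap_eq]
    simp [← mul_assoc, ← C_mul, e]
  have hev : eval ![0, 0, 1] (σ q) = eval ![-b₂ / a₂, -b₃ / a₃, 1] q := by
    have : (aeval ![(0 : ℂ), 0, 1]).comp σ = aeval ![-b₂ / a₂, -b₃ / a₃, 1] := by
      apply MvPolynomial.algHom_ext
      intro i
      fin_cases i <;> simp [σ]
    simpa using DFunLike.congr_fun this q
  have hne : σ q ≠ 0 := by
    intro h'
    rw [h', map_zero] at hev
    exact hq hev.symm
  have hp : σ p = 0 := by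
    have := congrArg σ h
    rw [map_add, map_add, map_mul, map_mul, map_mul, h0, h1, zero_mul, zero_mul, add_zero,
      add_zero, map_zero, mul_eq_zero] at this
    exact this.resolve_left hne
  have := hσ p
  rw [hp, sub_zero, Ideal.mem_span_pair] at this
  obtain ⟨α, β, hαβ⟩ := this
  exact ⟨α, β, by rw [← hαβ]; ring⟩

end LinearForms

/-! ### Nearly free curves -/

/-- Three syzygies of degrees `d, k + 1, k + 1` of `f` with one relation, whose coefficients are a
quadratic form and two linear forms without common zero. -/
structure NearlyFreeData (f : S3) (d k : ℕ) (r₁ r₂ r₃ : Fin 3 → S3) (q : S3)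
    (a₂ b₂ a₃ b₃ c : ℂ) : Prop where
  prim : IsPrimitiveAlongZ (grad f)
  hom₁ : ∀ i, (r₁ i).IsHomogeneous d
  hom₂ : ∀ i, (r₂ i).IsHomogeneous (k + 1)
  hom₃ : ∀ i, (r₃ i).IsHomogeneous (k + 1)
  homq : q.IsHomogeneous 2
  deg : d + 1 = k + 1
  ha₂ : a₂ ≠ 0
  ha₃ : a₃ ≠ 0
  hc : c ≠ 0
  hq : eval ![-b₂ / a₂, -b₃ / a₃, 1] q ≠ 0
  rel : q • r₁ + linForm 0 a₂ b₂ • r₂ + linForm 1 a₃ b₃ • r₃ = 0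
  cross₁₂ : r₁ ⨯₃ r₂ = (C c * linForm 1 a₃ b₃) • grad f

namespace NearlyFreeData

variable {f : S3} {d k : ℕ} {r₁ r₂ r₃ : Fin 3 → S3} {q : S3} {a₂ b₂ a₃ b₃ c : ℂ}
  (h : NearlyFreeData f d k r₁ r₂ r₃ q a₂ b₂ a₃ b₃ c)
include h

theorem linForm_one_ne_zero : linForm 1 a₃ b₃ ≠ 0 := by
  intro h0
  have := congrArg (eval ![0, 1, 0]) h0
  simp [eval_linForm] at this
  exact h.ha₃ this

theorem C_ne_zero : (C c : S3) ≠ 0 := by simpa using h.hc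

theorem cross₁₃ : r₁ ⨯₃ r₃ = -((C c * linForm 0 a₂ b₂) • grad f) := by
  have hrel := congrArg (fun u => r₁ ⨯₃ u) h.rel
  simp only [map_add, map_smul, cross_self, smul_zero, zero_add, map_zero, h.cross₁₂] at hrel
  apply smul_right_injective _ h.linForm_one_ne_zero
  funext i
  have := congrFun hrel i
  simp only [Pi.add_apply, Pi.smul_apply, Pi.zero_apply, Pi.neg_apply, smul_eq_mul] at this ⊢
  linear_combination this

theorem cross₂₃ : r₂ ⨯₃ r₃ = (C c * q) • grad f := by
  have hrel := congrArg (fun u => r₂ ⨯₃ u) h.rel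
  have h₂₁ : r₂ ⨯₃ r₁ = -((C c * linForm 1 a₃ b₃) • grad f) := by
    rw [← h.cross₁₂, cross_anticomm]
  simp only [map_add, map_smul, cross_self, smul_zero, add_zero, map_zero, h₂₁] at hrel
  apply smul_right_injective _ h.linForm_one_ne_zero
  funext i
  have := congrFun hrel i
  simp only [Pi.add_apply, Pi.smul_apply, Pi.zero_apply, Pi.neg_apply, smul_eq_mul] at this ⊢
  linear_combination this

theorem cross₁₂_ne_zero : r₁ ⨯₃ r₂ ≠ 0 :=
  h.cross₁₂ ▸ smul_ne_zero (mul_ne_zero h.C_ne_zero h.linForm_one_ne_zero) h.prim.ne_zero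

theorem q_ne_zero : q ≠ 0 := by
  rintro rfl
  exact h.hq (map_zero _)

theorem mem₁ : r₁ ∈ jacSyz f :=
  mem_jacSyz_of_cross_left (mul_ne_zero h.C_ne_zero h.linForm_one_ne_zero) h.cross₁₂

theorem mem₂ : r₂ ∈ jacSyz f :=
  mem_jacSyz_of_cross_right (mul_ne_zero h.C_ne_zero h.linForm_one_ne_zero) h.cross₁₂

theorem mem₃ : r₃ ∈ jacSyz f :=
  mem_jacSyz_of_cross_right (mul_ne_zero h.C_ne_zero h.q_ne_zero) h.cross₂₃

theorem notMem_span₁ : r₁ ∉ Submodule.span S3 {r₂, r₃} := by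
  intro hmem
  obtain ⟨a, b, hab⟩ := Submodule.mem_span_pair.mp hmem
  have hx := congrArg (fun u => r₂ ⨯₃ u) hab
  simp only [map_add, map_smul, cross_self, smul_zero, zero_add, h.cross₂₃] at hx
  rw [← cross_anticomm, h.cross₁₂, smul_smul, ← neg_smul] at hx
  have hx' : C c * (b * q) = C c * -linForm 1 a₃ b₃ := by
    linear_combination smul_grad_injective h.prim hx
  have hx'' := mul_left_cancel₀ h.C_ne_zero hx'
  have hb : b ≠ 0 := by
    rintro rfl
    rw [zero_mul, eq_comm, neg_eq_zero] at hx''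
    exact h.linForm_one_ne_zero hx''
  have hdeg := congrArg totalDegree hx''
  rw [totalDegree_mul_of_isDomain hb h.q_ne_zero, totalDegree_neg,
    h.homq.totalDegree h.q_ne_zero,
    (isHomogeneous_linForm 1 a₃ b₃).totalDegree h.linForm_one_ne_zero] at hdeg
  omega

theorem notMem_span₂ : r₂ ∉ Submodule.span S3 {r₁, r₃} := by
  intro hmem
  obtain ⟨a, b, hab⟩ := Submodule.mem_span_pair.mp hmem
  have hx := congrArg (fun u => r₁ ⨯₃ u) hab
  simp only [map_add, map_smul, cross_self, smul_zero, zero_add, h.cross₁₃, h.cross₁₂] at hx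
  rw [smul_neg, smul_smul, ← neg_smul] at hx
  have hx' : C c * (b * -linForm 0 a₂ b₂) = C c * linForm 1 a₃ b₃ := by
    linear_combination smul_grad_injective h.prim hx
  have hev := congrArg (eval ![-b₂ / a₂, -b₃ / a₃ + 1, 1]) (mul_left_cancel₀ h.C_ne_zero hx')
  have h₂ := h.ha₂
  have h₃ := h.ha₃
  have e₂ : a₂ * (-b₂ / a₂) = -b₂ := by field_simp
  have e₃ : a₃ * (-b₃ / a₃) = -b₃ := by field_simp
  simp [eval_linForm, mul_add, e₂, e₃] at hev
  exact h₃ hev.symm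

theorem notMem_span₃ : r₃ ∉ Submodule.span S3 {r₁, r₂} := by
  intro hmem
  obtain ⟨a, b, hab⟩ := Submodule.mem_span_pair.mp hmem
  have hx := congrArg (fun u => r₁ ⨯₃ u) hab
  simp only [map_add, map_smul, cross_self, smul_zero, zero_add, h.cross₁₃, h.cross₁₂] at hx
  rw [smul_smul, ← neg_smul] at hx
  have hx' : C c * (b * linForm 1 a₃ b₃) = C c * -linForm 0 a₂ b₂ := by
    linear_combination smul_grad_injective h.prim hx
  have hev := congrArg (eval ![-b₂ / a₂ + 1, -b₃ / a₃, 1]) (mul_left_cancel₀ h.C_ne_zero hx')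
  have h₂ := h.ha₂
  have h₃ := h.ha₃
  have e₂ : a₂ * (-b₂ / a₂) = -b₂ := by field_simp
  have e₃ : a₃ * (-b₃ / a₃) = -b₃ := by field_simp
  simp [eval_linForm, mul_add, e₂, e₃] at hev
  exact h₂ hev

theorem mem_span {w : Fin 3 → S3} (hw : w ∈ jacSyz f) :
    ∃ x y z : S3, w = x • r₁ + y • r₂ + z • r₃ := by
  have hinv : (C c⁻¹ * C c : S3) = 1 := by rw [← C_mul, inv_mul_cancel₀ h.hc, C_1]
  obtain ⟨t₁, ht₁⟩ := exists_cross_eq_smul_grad h.prim hw h.mem₁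
  obtain ⟨t₂, ht₂⟩ := exists_cross_eq_smul_grad h.prim hw h.mem₂
  obtain ⟨t₃, ht₃⟩ := exists_cross_eq_smul_grad h.prim hw h.mem₃
  have hrel := congrArg (fun u => w ⨯₃ u) h.rel
  simp only [map_add, map_smul, map_zero, ht₁, ht₂, ht₃, smul_smul, ← add_smul] at hrel
  have ht := (smul_eq_zero.mp hrel).resolve_right h.prim.ne_zero
  obtain ⟨α, β, rfl⟩ := exists_eq_linForm_comb h.ha₂ h.ha₃ h.hq ht
  have ht' : linForm 0 a₂ b₂ * (t₂ + q * α) + linForm 1 a₃ b₃ * (t₃ + q * β) = 0 := by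
    linear_combination ht
  obtain ⟨γ, hγ⟩ := linForm_dvd_of_mul_add_mul_eq_zero h.ha₂ h.ha₃ ht'
  refine ⟨C c⁻¹ * γ, -(C c⁻¹ * β), C c⁻¹ * α, sub_eq_zero.mp ?_⟩
  apply eq_zero_of_cross_eq_zero h.cross₁₂_ne_zero
  · have h₂₁ : r₂ ⨯₃ r₁ = -((C c * linForm 1 a₃ b₃) • grad f) := by
      rw [← h.cross₁₂, cross_anticomm]
    have h₃₁ : r₃ ⨯₃ r₁ = (C c * linForm 0 a₂ b₂) • grad f := by
      rw [← cross_anticomm, h.cross₁₃, neg_neg]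
    simp only [map_sub, map_add, map_smul, LinearMap.sub_apply, LinearMap.add_apply,
      LinearMap.smul_apply, cross_self, ht₁, h₂₁, h₃₁]
    funext i
    simp only [Pi.sub_apply, Pi.add_apply, Pi.smul_apply, Pi.neg_apply, Pi.zero_apply,
      smul_eq_mul]
    linear_combination
      -(linForm 0 a₂ b₂ * α + linForm 1 a₃ b₃ * β) * grad f i * hinv
  · have h₃₂ : r₃ ⨯₃ r₂ = -((C c * q) • grad f) := by
      rw [← h.cross₂₃, cross_anticomm]
    simp only [map_sub, map_add, map_smul, LinearMap.sub_apply, LinearMap.add_apply,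
      LinearMap.smul_apply, cross_self, ht₂, h.cross₁₂, h₃₂]
    funext i
    simp only [Pi.sub_apply, Pi.add_apply, Pi.smul_apply, Pi.neg_apply, Pi.zero_apply,
      smul_eq_mul]
    linear_combination grad f i * hγ + (q * α - linForm 1 a₃ b₃ * γ) * grad f i * hinv

theorem isMinGenSyz : IsMinGenSyz f 3 ![d, k + 1, k + 1] ![r₁, r₂, r₃] := by
  have hforall : ∀ {P : Fin 3 → Prop}, P 0 → P 1 → P 2 → ∀ j, P j := by
    intro P p₀ p₁ p₂ j
    fin_cases j
    exacts [p₀, p₁, p₂]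
  have e₁ : {j' : Fin 3 | j' ≠ 0} = {1, 2} := by ext j; fin_cases j <;> simp
  have e₂ : {j' : Fin 3 | j' ≠ 1} = {0, 2} := by ext j; fin_cases j <;> simp
  have e₃ : {j' : Fin 3 | j' ≠ 2} = {0, 1} := by ext j; fin_cases j <;> simp
  have hmin : ∀ j, (![r₁, r₂, r₃] : Fin 3 → Fin 3 → S3) j ∉
      Submodule.span S3 (![r₁, r₂, r₃] '' {j' | j' ≠ j}) := by
    apply hforall
    · rw [e₁, Set.image_pair]
      exact h.notMem_span₁
    · rw [e₂, Set.image_pair]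
      exact h.notMem_span₂
    · rw [e₃, Set.image_pair]
      exact h.notMem_span₃
  refine ⟨hforall h.mem₁ h.mem₂ h.mem₃, hforall h.hom₁ h.hom₂ h.hom₃, ?_, ?_, hmin, ?_⟩
  · intro j hj
    exact hmin j (hj ▸ Submodule.zero_mem _)
  · apply le_antisymm
    · rw [Submodule.span_le]
      rintro _ ⟨j, rfl⟩
      exact hforall (P := fun j => (![r₁, r₂, r₃] : Fin 3 → Fin 3 → S3) j ∈ jacSyz f)
        h.mem₁ h.mem₂ h.mem₃ j
    · intro w hw
      obtain ⟨x, y, z, rfl⟩ := h.mem_span hw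
      rw [Submodule.mem_span_range_iff_exists_fun]
      exact ⟨![x, y, z], by simp [Fin.sum_univ_three]⟩
  · have := h.deg
    rw [Fin.monotone_iff_le_succ, Fin.forall_fin_two]
    simp
    omega

theorem combMap_eq_zero_iff {a : Fin 3 → S3} : combMap ![r₁, r₂, r₃] a = 0 ↔
    ∃ t : S3, a = t • (![q, linForm 0 a₂ b₂, linForm 1 a₃ b₃] : Fin 3 → S3) := by
  rw [combMap_apply, Fin.sum_univ_three]
  change a 0 • r₁ + a 1 • r₂ + a 2 • r₃ = 0 ↔ _
  constructor
  · intro ha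
    have hx₁ := congrArg (fun u => r₁ ⨯₃ u) ha
    have hx₂ := congrArg (fun u => r₂ ⨯₃ u) ha
    have h₂₁ : r₂ ⨯₃ r₁ = -((C c * linForm 1 a₃ b₃) • grad f) := by
      rw [← h.cross₁₂, cross_anticomm]
    simp only [map_add, map_smul, cross_self, smul_zero, zero_add, add_zero, map_zero,
      h.cross₁₂, h.cross₁₃, h.cross₂₃, h₂₁, ← neg_smul, smul_smul, ← add_smul, smul_eq_zero,
      h.prim.ne_zero, or_false] at hx₁ hx₂
    have hy₁ : linForm 0 a₂ b₂ * a 2 + linForm 1 a₃ b₃ * -a 1 = 0 := by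
      apply (mul_eq_zero.mp (?_ : C c * _ = 0)).resolve_left h.C_ne_zero
      linear_combination -hx₁
    have hy₂ : linForm 1 a₃ b₃ * a 0 = a 2 * q := by
      apply mul_left_cancel₀ h.C_ne_zero
      linear_combination -hx₂
    obtain ⟨t, ht⟩ := linForm_dvd_of_mul_add_mul_eq_zero h.ha₂ h.ha₃ hy₁
    have hl := h.linForm_one_ne_zero
    refine ⟨t, funext fun j => ?_⟩
    fin_cases j
    · apply mul_left_cancel₀ hl
      change linForm 1 a₃ b₃ * a 0 = linForm 1 a₃ b₃ * (t * q)
      linear_combination hy₂ + q * ht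
    · apply mul_left_cancel₀ hl
      change linForm 1 a₃ b₃ * a 1 = linForm 1 a₃ b₃ * (t * linForm 0 a₂ b₂)
      linear_combination -hy₁ + linForm 0 a₂ b₂ * ht
    · simp [ht, mul_comm]
  · rintro ⟨t, rfl⟩
    have := congrArg (fun u => t • u) h.rel
    simpa [smul_add, smul_smul] using this

theorem finrank_relations (n : ℕ) : Module.finrank ℂ
    ↥(homTuples (fun j => n + d + k + 2 - ![d, k + 1, k + 1] j) ⊓
      LinearMap.ker (combMap ![r₁, r₂, r₃])) = (n + d + 2).choose 2 := by
  let s : Fin 3 → S3 := ![q, linForm 0 a₂ b₂, linForm 1 a₃ b₃]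
  let T : S3 →ₗ[ℂ] (Fin 3 → S3) := (LinearMap.toSpanSingleton S3 _ s).restrictScalars ℂ
  have hT : ∀ t, T t = t • s := fun t => rfl
  have hs : s ≠ 0 := fun h0 => h.q_ne_zero (congrFun h0 0)
  have hdeg : ∀ j, (s j).IsHomogeneous
      (n + d + k + 2 - ![d, k + 1, k + 1] j - (n + d)) := by
    have hd := h.deg
    intro j
    fin_cases j
    · change q.IsHomogeneous (n + d + k + 2 - d - (n + d))
      rw [show n + d + k + 2 - d - (n + d) = 2 by omega]
      exact h.homq
    · change (linForm 0 a₂ b₂).IsHomogeneous (n + d + k + 2 - (k + 1) - (n + d))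
      rw [show n + d + k + 2 - (k + 1) - (n + d) = 1 by omega]
      exact isHomogeneous_linForm 0 a₂ b₂
    · change (linForm 1 a₃ b₃).IsHomogeneous (n + d + k + 2 - (k + 1) - (n + d))
      rw [show n + d + k + 2 - (k + 1) - (n + d) = 1 by omega]
      exact isHomogeneous_linForm 1 a₃ b₃
  have hle : ∀ j, n + d ≤ n + d + k + 2 - ![d, k + 1, k + 1] j := by
    have hd := h.deg
    intro j
    fin_cases j <;> simp <;> omega
  have hmap : (homogeneousSubmodule (Fin 3) ℂ (n + d)).map T =
      homTuples (fun j => n + d + k + 2 - ![d, k + 1, k + 1] j) ⊓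
        LinearMap.ker (combMap ![r₁, r₂, r₃]) := by
    ext a
    simp only [Submodule.mem_map, Submodule.mem_inf, LinearMap.mem_ker, h.combMap_eq_zero_iff,
      mem_homTuples, mem_homogeneousSubmodule, hT]
    constructor
    · rintro ⟨t, ht, rfl⟩
      refine ⟨fun j => ?_, t, rfl⟩
      have := ht.mul (hdeg j)
      rwa [Nat.add_sub_cancel' (hle j)] at this
    · rintro ⟨ha, t, rfl⟩
      refine ⟨homogeneousComponent (n + d) t, homogeneousComponent_isHomogeneous _ _, ?_⟩
      funext j
      rw [← homogeneousComponent_eq_self (ha j)]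
      have := homogeneousComponent_mul_of_isHomogeneous (hdeg j) t (n + d)
      rw [Nat.add_sub_cancel' (hle j)] at this
      exact this.symm
  have hker : LinearMap.ker T = ⊥ := by
    rw [LinearMap.ker_eq_bot']
    intro t ht
    exact (smul_eq_zero.mp ht).resolve_right hs
  have hrank := finrank_map_add_finrank_inf_ker T (homogeneousSubmodule (Fin 3) ℂ (n + d))
  rwa [hmap, hker, inf_bot_eq, finrank_bot, add_zero,
    finrank_homogeneousSubmodule_fin_three] at hrank

theorem isTjurina {e τ : ℕ} (hf : f.IsHomogeneous (e + 1)) (he : d + k = e)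
    (hτ : τ + d * k + 1 = e ^ 2) : IsTjurina f τ := by
  have hd := h.deg
  filter_upwards [Filter.eventually_ge_atTop (d + k + 2 + e)] with m hm
  obtain ⟨n, rfl⟩ := Nat.exists_eq_add_of_le hm
  have hM := milnorDim_add_sum hf h.isMinGenSyz (n + d + k + 2) (by
    intro j
    fin_cases j <;> simp <;> omega)
  rw [h.finrank_relations, Fin.sum_univ_three] at hM
  simp only [Matrix.cons_val] at hM
  rw [show n + d + k + 2 - d = n + k + 2 by omega,
    show n + d + k + 2 - (k + 1) = n + d + 1 by omega,
    show n + d + k + 2 + e = d + k + 2 + e + n by ring] at hM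
  have hM' := congrArg (Nat.cast : ℕ → ℚ) hM
  have hτ' := congrArg (Nat.cast : ℕ → ℚ) hτ
  subst he
  push_cast [cast_choose_add_two] at hM' hτ'
  have : (milnorDim f (d + k + 2 + (d + k) + n) : ℚ) = τ := by
    linear_combination hM' - hτ'
  exact_mod_cast this

end NearlyFreeData

/-! ### Explicit polynomials in `ℂ[x, y, z]` -/

local notation "𝐱" => (X 0 : S3)
local notation "𝐲" => (X 1 : S3)
local notation "𝐳" => (X 2 : S3)

theorem isHomogeneous_of_eq {p : S3} {m n : ℕ} (hp : p.IsHomogeneous m) (h : m = n) :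
    p.IsHomogeneous n := h ▸ hp

theorem isHomogeneous_ofNat (n : ℕ) [n.AtLeastTwo] :
    (OfNat.ofNat n : S3).IsHomogeneous 0 := by
  rw [← map_ofNat (C : ℂ →+* S3) n]
  exact isHomogeneous_C _ _

theorem forall_vec_isHomogeneous {p q r : S3} {n : ℕ} (hp : p.IsHomogeneous n)
    (hq : q.IsHomogeneous n) (hr : r.IsHomogeneous n) :
    ∀ i, ((![p, q, r] : Fin 3 → S3) i).IsHomogeneous n := by
  intro i
  fin_cases i
  exacts [hp, hq, hr]

theorem cross_vec_eq_smul {p q r p' q' r' t g₀ g₁ g₂ : S3} (h₀ : q * r' - r * q' = t * g₀)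
    (h₁ : r * p' - p * r' = t * g₁) (h₂ : p * q' - q * p' = t * g₂) :
    ![p, q, r] ⨯₃ ![p', q', r'] = t • ![g₀, g₁, g₂] := by
  rw [cross_apply]
  simpa using ⟨h₀, h₁, h₂⟩

theorem mem_ideal_of_C_mul_mem {I : Ideal S3} {c : ℂ} (hc : c ≠ 0) {p : S3} (h : C c * p ∈ I) :
    p ∈ I := by
  have := I.mul_mem_left (C c⁻¹) h
  rwa [← mul_assoc, ← C_mul, inv_mul_cancel₀ hc, C_1, one_mul] at this

theorem not_X_two_dvd_of_eval_ne_zero {p : S3} (h : eval ![1, 1, 0] p ≠ 0) : ¬ 𝐳 ∣ p := by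
  rintro ⟨q, rfl⟩
  simp at h

/-! ### The pencil spanned by `f₀` and `z¹⁰` -/

theorem three_mul_C_third : (3 : S3) * C (3⁻¹ : ℂ) = 1 := by
  rw [← map_ofNat (C : ℂ →+* S3) 3, ← C_mul]
  norm_num

theorem C_div_three (n : ℕ) [n.AtLeastTwo] :
    (C (OfNat.ofNat n / 3 : ℂ) : S3) = OfNat.ofNat n * C 3⁻¹ := by
  rw [div_eq_mul_inv, C_mul, map_ofNat]

theorem pderiv_ofNat (i : Fin 3) (n : ℕ) [n.AtLeastTwo] :
    pderiv i (ofNat(n) : S3) = 0 := by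
  rw [← map_ofNat (C : ℂ →+* S3) n, pderiv_C]

theorem three_mul_f0 : 3 * f0 =
    3 * 𝐱 ^ 6 * 𝐲 ^ 4 + 12 * 𝐱 ^ 5 * 𝐲 ^ 3 * 𝐳 ^ 2 + 9 * 𝐱 ^ 4 * 𝐲 ^ 3 * 𝐳 ^ 3 +
      18 * 𝐱 ^ 4 * 𝐲 ^ 2 * 𝐳 ^ 4 + 19 * 𝐱 ^ 3 * 𝐲 ^ 2 * 𝐳 ^ 5 + 12 * 𝐱 ^ 3 * 𝐲 * 𝐳 ^ 6 +
      9 * 𝐱 ^ 2 * 𝐲 ^ 2 * 𝐳 ^ 6 + 11 * 𝐱 ^ 2 * 𝐲 * 𝐳 ^ 7 + 3 * 𝐱 ^ 2 * 𝐳 ^ 8 + 6 * 𝐱 * 𝐲 * 𝐳 ^ 8 +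
      𝐱 * 𝐳 ^ 9 + 3 * 𝐲 * 𝐳 ^ 9 - 3 * 𝐳 ^ 10 := by
  rw [f0, C_div_three, C_div_three, one_div]
  linear_combination
    (19 * 𝐱 ^ 3 * 𝐲 ^ 2 * 𝐳 ^ 5 + 11 * 𝐱 ^ 2 * 𝐲 * 𝐳 ^ 7 + 𝐱 * 𝐳 ^ 9) * three_mul_C_third

theorem three_mul_pderiv_zero_f0 : 3 * pderiv 0 f0 =
    18 * 𝐱 ^ 5 * 𝐲 ^ 4 + 60 * 𝐱 ^ 4 * 𝐲 ^ 3 * 𝐳 ^ 2 + 36 * 𝐱 ^ 3 * 𝐲 ^ 3 * 𝐳 ^ 3 +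
      72 * 𝐱 ^ 3 * 𝐲 ^ 2 * 𝐳 ^ 4 + 57 * 𝐱 ^ 2 * 𝐲 ^ 2 * 𝐳 ^ 5 + 36 * 𝐱 ^ 2 * 𝐲 * 𝐳 ^ 6 +
      18 * 𝐱 * 𝐲 ^ 2 * 𝐳 ^ 6 + 22 * 𝐱 * 𝐲 * 𝐳 ^ 7 + 6 * 𝐱 * 𝐳 ^ 8 + 6 * 𝐲 * 𝐳 ^ 8 + 𝐳 ^ 9 := by
  rw [f0, C_div_three, C_div_three, one_div]
  simp [pderiv_ofNat]
  linear_combination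
    (57 * 𝐱 ^ 2 * 𝐲 ^ 2 * 𝐳 ^ 5 + 22 * 𝐱 * 𝐲 * 𝐳 ^ 7 + 𝐳 ^ 9) * three_mul_C_third

theorem three_mul_pderiv_one_f0 : 3 * pderiv 1 f0 =
    12 * 𝐱 ^ 6 * 𝐲 ^ 3 + 36 * 𝐱 ^ 5 * 𝐲 ^ 2 * 𝐳 ^ 2 + 27 * 𝐱 ^ 4 * 𝐲 ^ 2 * 𝐳 ^ 3 +
      36 * 𝐱 ^ 4 * 𝐲 * 𝐳 ^ 4 + 38 * 𝐱 ^ 3 * 𝐲 * 𝐳 ^ 5 + 12 * 𝐱 ^ 3 * 𝐳 ^ 6 +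
      18 * 𝐱 ^ 2 * 𝐲 * 𝐳 ^ 6 + 11 * 𝐱 ^ 2 * 𝐳 ^ 7 + 6 * 𝐱 * 𝐳 ^ 8 + 3 * 𝐳 ^ 9 := by
  rw [f0, C_div_three, C_div_three, one_div]
  simp [pderiv_ofNat]
  linear_combination
    (38 * 𝐱 ^ 3 * 𝐲 * 𝐳 ^ 5 + 11 * 𝐱 ^ 2 * 𝐳 ^ 7) * three_mul_C_third

theorem three_mul_pderiv_two_f0 : 3 * pderiv 2 f0 =
    24 * 𝐱 ^ 5 * 𝐲 ^ 3 * 𝐳 + 27 * 𝐱 ^ 4 * 𝐲 ^ 3 * 𝐳 ^ 2 + 72 * 𝐱 ^ 4 * 𝐲 ^ 2 * 𝐳 ^ 3 +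
      95 * 𝐱 ^ 3 * 𝐲 ^ 2 * 𝐳 ^ 4 + 72 * 𝐱 ^ 3 * 𝐲 * 𝐳 ^ 5 + 54 * 𝐱 ^ 2 * 𝐲 ^ 2 * 𝐳 ^ 5 +
      77 * 𝐱 ^ 2 * 𝐲 * 𝐳 ^ 6 + 24 * 𝐱 ^ 2 * 𝐳 ^ 7 + 48 * 𝐱 * 𝐲 * 𝐳 ^ 7 + 9 * 𝐱 * 𝐳 ^ 8 +
      27 * 𝐲 * 𝐳 ^ 8 - 30 * 𝐳 ^ 9 := by
  rw [f0, C_div_three, C_div_three, one_div]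
  simp [pderiv_ofNat]
  linear_combination
    (95 * 𝐱 ^ 3 * 𝐲 ^ 2 * 𝐳 ^ 4 + 77 * 𝐱 ^ 2 * 𝐲 * 𝐳 ^ 6 + 9 * 𝐱 * 𝐳 ^ 8) * three_mul_C_third

theorem isHomogeneous_f0 : f0.IsHomogeneous 10 := by
  unfold f0
  repeat' first | apply IsHomogeneous.add | apply IsHomogeneous.sub
  all_goals
    apply isHomogeneous_of_eq
    · repeat' first
        | exact isHomogeneous_X_pow _ _ | exact isHomogeneous_X _ _ | exact isHomogeneous_C _ _
        | exact isHomogeneous_ofNat _ | apply IsHomogeneous.mul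
    · rfl

theorem X_two_pow_fourteen_eq : 𝐳 ^ 14 =
    (4 * 𝐱 ^ 4 * 𝐲 + 4 * 𝐱 ^ 3 * 𝐳 ^ 2 + 𝐱 ^ 2 * 𝐳 ^ 3) * pderiv 0 f0 +
    (-6 * 𝐱 ^ 3 * 𝐲 ^ 2 - 8 * 𝐱 ^ 2 * 𝐲 * 𝐳 ^ 2 - 2 * 𝐱 * 𝐳 ^ 4 + 𝐳 ^ 5) * pderiv 1 f0 := by
  apply mul_left_cancel₀ (left_ne_zero_of_mul_eq_one three_mul_C_third)
  linear_combination
    -(4 * 𝐱 ^ 4 * 𝐲 + 4 * 𝐱 ^ 3 * 𝐳 ^ 2 + 𝐱 ^ 2 * 𝐳 ^ 3) * three_mul_pderiv_zero_f0 -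
    (-6 * 𝐱 ^ 3 * 𝐲 ^ 2 - 8 * 𝐱 ^ 2 * 𝐲 * 𝐳 ^ 2 - 2 * 𝐱 * 𝐳 ^ 4 + 𝐳 ^ 5) * three_mul_pderiv_one_f0

theorem euler_f0 : 𝐱 * pderiv 0 f0 + 𝐲 * pderiv 1 f0 + 𝐳 * pderiv 2 f0 = 10 * f0 := by
  apply mul_left_cancel₀ (left_ne_zero_of_mul_eq_one three_mul_C_third)
  linear_combination 𝐱 * three_mul_pderiv_zero_f0 + 𝐲 * three_mul_pderiv_one_f0 +
    𝐳 * three_mul_pderiv_two_f0 - 10 * three_mul_f0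

/-- The member `f₀ + t z¹⁰` of the pencil spanned by `f₀` and `z¹⁰`. -/
def pencil (t : ℂ) : S3 := f0 + C t * 𝐳 ^ 10

theorem f0_eq_pencil : f0 = pencil 0 := by simp [pencil]

theorem fb_eq_pencil : fb = pencil (16 / 9) := rfl

theorem f1_eq_pencil : f1 = pencil (-1) := by simp [pencil, f1, sub_eq_add_neg]

theorem isHomogeneous_pencil (t : ℂ) : (pencil t).IsHomogeneous 10 :=
  isHomogeneous_f0.add ((isHomogeneous_X_pow 2 10).C_mul t)

theorem isHomogeneous_X_two_mul_pencil (t : ℂ) : (𝐳 * pencil t).IsHomogeneous 11 :=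
  isHomogeneous_of_eq ((isHomogeneous_X ℂ 2).mul (isHomogeneous_pencil t)) rfl

theorem grad_X_two_mul_pencil (t : ℂ) : grad (𝐳 * pencil t) =
    ![𝐳 * pderiv 0 f0, 𝐳 * pderiv 1 f0, f0 + 𝐳 * pderiv 2 f0 + 11 * C t * 𝐳 ^ 10] := by
  funext i
  fin_cases i
  · simp [grad, pencil]
  · simp [grad, pencil]
  · simp [grad, pencil]
    ring

theorem eval_f0 : eval ![1, 1, 0] f0 = 1 := by simp [f0]

theorem isPrimitiveAlongZ_grad_X_two_mul_pencil (t : ℂ) :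
    IsPrimitiveAlongZ (grad (𝐳 * pencil t)) := by
  rw [grad_X_two_mul_pencil]
  refine ⟨⟨15, ?_⟩, 2, not_X_two_dvd_of_eval_ne_zero (by simp [eval_f0])⟩
  rw [Ideal.mem_span_range_iff_exists_fun]
  refine ⟨![4 * 𝐱 ^ 4 * 𝐲 + 4 * 𝐱 ^ 3 * 𝐳 ^ 2 + 𝐱 ^ 2 * 𝐳 ^ 3,
    -6 * 𝐱 ^ 3 * 𝐲 ^ 2 - 8 * 𝐱 ^ 2 * 𝐲 * 𝐳 ^ 2 - 2 * 𝐱 * 𝐳 ^ 4 + 𝐳 ^ 5, 0], ?_⟩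
  simp [Fin.sum_univ_three]
  linear_combination -𝐳 * X_two_pow_fourteen_eq

/-! ### The curve `z f_b = 0` -/

/-- A syzygy of degree `4` of `z f_b`. -/
def syzFb₁ : Fin 3 → S3 :=
  ![100 * 𝐱 ^ 3 * 𝐲 + 100 * 𝐱 ^ 2 * 𝐳 ^ 2 + 64 * 𝐱 * 𝐳 ^ 3,
    -153 * 𝐱 ^ 2 * 𝐲 ^ 2 - 230 * 𝐱 * 𝐲 * 𝐳 ^ 2 - 90 * 𝐲 * 𝐳 ^ 3 - 77 * 𝐳 ^ 4,
    12 * 𝐱 ^ 2 * 𝐲 * 𝐳 + 12 * 𝐱 * 𝐳 ^ 3 + 9 * 𝐳 ^ 4]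

theorem isHomogeneous_syzFb₁ : ∀ i, (syzFb₁ i).IsHomogeneous 4 := by
  apply forall_vec_isHomogeneous
  all_goals
    repeat' first | apply IsHomogeneous.add | apply IsHomogeneous.sub
  all_goals
    apply isHomogeneous_of_eq
    · repeat' first
        | exact isHomogeneous_X_pow _ _ | exact isHomogeneous_X _ _ | exact isHomogeneous_ofNat _
        | apply IsHomogeneous.mul | apply IsHomogeneous.neg
    · rfl

/-- A syzygy of degree `6` of `z f_b`. -/
def syzFb₂ : Fin 3 → S3 :=
  ![66 * 𝐱 ^ 4 * 𝐲 ^ 2 + 132 * 𝐱 ^ 3 * 𝐲 * 𝐳 ^ 2 + 124 * 𝐱 ^ 2 * 𝐲 * 𝐳 ^ 3 + 66 * 𝐱 ^ 2 * 𝐳 ^ 4 +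
      36 * 𝐱 * 𝐳 ^ 5 + 22 * 𝐳 ^ 6,
    -99 * 𝐱 ^ 3 * 𝐲 ^ 3 - 231 * 𝐱 ^ 2 * 𝐲 ^ 2 * 𝐳 ^ 2 - 162 * 𝐱 * 𝐲 ^ 2 * 𝐳 ^ 3 -
      165 * 𝐱 * 𝐲 * 𝐳 ^ 4 - 74 * 𝐲 * 𝐳 ^ 5 - 33 * 𝐳 ^ 6,
    3 * 𝐱 * 𝐲 * 𝐳 ^ 4 + 3 * 𝐳 ^ 6]

theorem isHomogeneous_syzFb₂ : ∀ i, (syzFb₂ i).IsHomogeneous 6 := by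
  apply forall_vec_isHomogeneous
  all_goals
    repeat' first | apply IsHomogeneous.add | apply IsHomogeneous.sub
  all_goals
    apply isHomogeneous_of_eq
    · repeat' first
        | exact isHomogeneous_X_pow _ _ | exact isHomogeneous_X _ _ | exact isHomogeneous_ofNat _
        | apply IsHomogeneous.mul | apply IsHomogeneous.neg
    · rfl

theorem nine_mul_C : (9 : S3) * C (16 / 9 : ℂ) = 16 := by
  rw [← map_ofNat (C : ℂ →+* S3) 9, ← C_mul, ← map_ofNat (C : ℂ →+* S3) 16]
  norm_num

theorem cross_syzFb :
    syzFb₁ ⨯₃ syzFb₂ = (C 198 : S3) • grad (𝐳 * pencil (16 / 9)) := by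
  rw [grad_X_two_mul_pencil, map_ofNat C 198]
  apply cross_vec_eq_smul
  · linear_combination -66 * 𝐳 * three_mul_pderiv_zero_f0
  · linear_combination -66 * 𝐳 * three_mul_pderiv_one_f0
  · linear_combination -66 * (three_mul_f0 + 𝐳 * three_mul_pderiv_two_f0) -
      242 * 𝐳 ^ 10 * nine_mul_C

/-! ### The curve `z f₀ = 0` -/

/-- A syzygy of degree `5` of `z f₀`. -/
def syzF0₁ : Fin 3 → S3 :=
  ![698368 * 𝐱 ^ 4 * 𝐲 + 8100 * 𝐱 ^ 3 * 𝐲 ^ 2 - 283008 * 𝐱 ^ 3 * 𝐲 * 𝐳 + 698368 * 𝐱 ^ 3 * 𝐳 ^ 2 +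
      86868 * 𝐱 ^ 2 * 𝐲 * 𝐳 ^ 2 + 240768 * 𝐱 ^ 2 * 𝐳 ^ 3 + 5184 * 𝐱 * 𝐲 * 𝐳 ^ 3 -
      9984 * 𝐱 * 𝐳 ^ 4 + 12672 * 𝐳 ^ 5,
    -1047552 * 𝐱 ^ 3 * 𝐲 ^ 2 - 12393 * 𝐱 ^ 2 * 𝐲 ^ 3 + 424512 * 𝐱 ^ 2 * 𝐲 ^ 2 * 𝐳 -
      1396736 * 𝐱 ^ 2 * 𝐲 * 𝐳 ^ 2 - 137862 * 𝐱 * 𝐲 ^ 2 * 𝐳 ^ 2 + 42240 * 𝐱 * 𝐲 * 𝐳 ^ 3 -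
      349184 * 𝐱 * 𝐳 ^ 4 - 7290 * 𝐲 ^ 2 * 𝐳 ^ 3 - 149805 * 𝐲 * 𝐳 ^ 4 + 141504 * 𝐳 ^ 5,
    972 * 𝐱 ^ 2 * 𝐲 ^ 2 * 𝐳 + 5292 * 𝐱 * 𝐲 * 𝐳 ^ 3 + 729 * 𝐲 * 𝐳 ^ 4 + 13248 * 𝐳 ^ 5]

theorem isHomogeneous_syzF0₁ : ∀ i, (syzF0₁ i).IsHomogeneous 5 := by
  apply forall_vec_isHomogeneous
  all_goals
    repeat' first | apply IsHomogeneous.add | apply IsHomogeneous.sub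
  all_goals
    apply isHomogeneous_of_eq
    · repeat' first
        | exact isHomogeneous_X_pow _ _ | exact isHomogeneous_X _ _ | exact isHomogeneous_ofNat _
        | apply IsHomogeneous.mul | apply IsHomogeneous.neg
    · rfl

/-- A syzygy of degree `6` of `z f₀`. -/
def syzF0₂ : Fin 3 → S3 :=
  ![594 * 𝐱 ^ 4 * 𝐲 ^ 2 + 5632 * 𝐱 ^ 4 * 𝐲 * 𝐳 - 1452 * 𝐱 ^ 3 * 𝐲 * 𝐳 ^ 2 + 5632 * 𝐱 ^ 3 * 𝐳 ^ 3 +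
      1116 * 𝐱 ^ 2 * 𝐲 * 𝐳 ^ 3 + 2178 * 𝐱 ^ 2 * 𝐳 ^ 4 + 132 * 𝐱 * 𝐳 ^ 5 + 198 * 𝐳 ^ 6,
    -891 * 𝐱 ^ 3 * 𝐲 ^ 3 - 8448 * 𝐱 ^ 3 * 𝐲 ^ 2 * 𝐳 + 1881 * 𝐱 ^ 2 * 𝐲 ^ 2 * 𝐳 ^ 2 -
      11264 * 𝐱 ^ 2 * 𝐲 * 𝐳 ^ 3 - 1458 * 𝐱 * 𝐲 ^ 2 * 𝐳 ^ 3 - 429 * 𝐱 * 𝐲 * 𝐳 ^ 4 -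
      2816 * 𝐱 * 𝐳 ^ 5 - 1386 * 𝐲 * 𝐳 ^ 5 + 1023 * 𝐳 ^ 6,
    27 * 𝐱 * 𝐲 * 𝐳 ^ 4 + 99 * 𝐳 ^ 6]

theorem isHomogeneous_syzF0₂ : ∀ i, (syzF0₂ i).IsHomogeneous 6 := by
  apply forall_vec_isHomogeneous
  all_goals
    repeat' first | apply IsHomogeneous.add | apply IsHomogeneous.sub
  all_goals
    apply isHomogeneous_of_eq
    · repeat' first
        | exact isHomogeneous_X_pow _ _ | exact isHomogeneous_X _ _ | exact isHomogeneous_ofNat _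
        | apply IsHomogeneous.mul | apply IsHomogeneous.neg
    · rfl

/-- A syzygy of degree `6` of `z f₀`. -/
def syzF0₃ : Fin 3 → S3 :=
  ![-300 * 𝐱 ^ 4 * 𝐲 ^ 2 + 5632 * 𝐱 ^ 4 * 𝐲 * 𝐳 - 2184 * 𝐱 ^ 3 * 𝐲 * 𝐳 ^ 2 + 5632 * 𝐱 ^ 3 * 𝐳 ^ 3 -
      192 * 𝐱 ^ 2 * 𝐲 * 𝐳 ^ 3 + 2340 * 𝐱 ^ 2 * 𝐳 ^ 4 + 192 * 𝐱 * 𝐳 ^ 5,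
    459 * 𝐱 ^ 3 * 𝐲 ^ 3 - 8448 * 𝐱 ^ 3 * 𝐲 ^ 2 * 𝐳 + 3525 * 𝐱 ^ 2 * 𝐲 ^ 2 * 𝐳 ^ 2 -
      11264 * 𝐱 ^ 2 * 𝐲 * 𝐳 ^ 3 + 270 * 𝐱 * 𝐲 ^ 2 * 𝐳 ^ 3 - 135 * 𝐱 * 𝐲 * 𝐳 ^ 4 -
      2816 * 𝐱 * 𝐳 ^ 5 - 930 * 𝐲 * 𝐳 ^ 5 + 1023 * 𝐳 ^ 6,
    -36 * 𝐱 ^ 3 * 𝐲 ^ 2 * 𝐳 - 72 * 𝐱 ^ 2 * 𝐲 * 𝐳 ^ 3 - 27 * 𝐱 * 𝐲 * 𝐳 ^ 4 - 36 * 𝐱 * 𝐳 ^ 5 +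
      93 * 𝐳 ^ 6]

theorem isHomogeneous_syzF0₃ : ∀ i, (syzF0₃ i).IsHomogeneous 6 := by
  apply forall_vec_isHomogeneous
  all_goals
    repeat' first | apply IsHomogeneous.add | apply IsHomogeneous.sub
  all_goals
    apply isHomogeneous_of_eq
    · repeat' first
        | exact isHomogeneous_X_pow _ _ | exact isHomogeneous_X _ _ | exact isHomogeneous_ofNat _
        | apply IsHomogeneous.mul | apply IsHomogeneous.neg
    · rfl

/-- The quadratic coefficient of the relation between the syzygies of `z f₀`. -/
def relF0 : S3 := 27 * 𝐱 * 𝐲 + 256 * 𝐱 * 𝐳 - 93 * 𝐳 ^ 2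

theorem isHomogeneous_relF0 : relF0.IsHomogeneous 2 := by
  unfold relF0
  repeat' first | apply IsHomogeneous.add | apply IsHomogeneous.sub
  all_goals
    apply isHomogeneous_of_eq
    · repeat' first
        | exact isHomogeneous_X_pow _ _ | exact isHomogeneous_X _ _ | exact isHomogeneous_ofNat _
        | apply IsHomogeneous.mul
    · rfl

theorem linForm_zero_relF0 : linForm 0 (-31744) 5952 = -31744 * 𝐱 + 5952 * 𝐳 := by
  rw [linForm, C_neg, map_ofNat C, map_ofNat C]

theorem linForm_one_relF0 : linForm 1 729 6912 = 729 * 𝐲 + 6912 * 𝐳 := by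
  rw [linForm, map_ofNat C, map_ofNat C]

theorem nearlyFreeData_syzF0 : NearlyFreeData (𝐳 * pencil 0) 5 5 syzF0₁ syzF0₂ syzF0₃
    relF0 (-31744) 5952 729 6912 198 where
  prim := isPrimitiveAlongZ_grad_X_two_mul_pencil _
  hom₁ := isHomogeneous_syzF0₁
  hom₂ := isHomogeneous_syzF0₂
  hom₃ := isHomogeneous_syzF0₃
  homq := isHomogeneous_relF0
  deg := rfl
  ha₂ := by norm_num
  ha₃ := by norm_num
  hc := by norm_num
  hq := by
    simp [relF0]
    norm_num
  rel := by
    rw [linForm_zero_relF0, linForm_one_relF0]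
    funext i
    fin_cases i
    all_goals
      simp [relF0, syzF0₁, syzF0₂, syzF0₃]
      ring
  cross₁₂ := by
    rw [grad_X_two_mul_pencil, linForm_one_relF0, map_ofNat C 198, C_0]
    apply cross_vec_eq_smul
    · linear_combination -(729 * 𝐲 + 6912 * 𝐳) * 66 * 𝐳 * three_mul_pderiv_zero_f0
    · linear_combination -(729 * 𝐲 + 6912 * 𝐳) * 66 * 𝐳 * three_mul_pderiv_one_f0
    · linear_combination -(729 * 𝐲 + 6912 * 𝐳) * 66 * (three_mul_f0 + 𝐳 * three_mul_pderiv_two_f0)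

/-! ### The curve `z f₁ = 0` -/

/-- A syzygy of degree `5` of `z f₁`. -/
def syzF1₁ : Fin 3 → S3 :=
  ![2942500 * 𝐱 ^ 4 * 𝐲 + 8100 * 𝐱 ^ 3 * 𝐲 ^ 2 - 813450 * 𝐱 ^ 3 * 𝐲 * 𝐳 + 2942500 * 𝐱 ^ 3 * 𝐳 ^ 2 +
      131175 * 𝐱 ^ 2 * 𝐲 * 𝐳 ^ 2 + 863775 * 𝐱 ^ 2 * 𝐳 ^ 3 + 5184 * 𝐱 * 𝐲 * 𝐳 ^ 3 -
      42600 * 𝐱 * 𝐳 ^ 4 + 19800 * 𝐳 ^ 5,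
    -4413750 * 𝐱 ^ 3 * 𝐲 ^ 2 - 12393 * 𝐱 ^ 2 * 𝐲 ^ 3 + 1220175 * 𝐱 ^ 2 * 𝐲 ^ 2 * 𝐳 -
      5885000 * 𝐱 ^ 2 * 𝐲 * 𝐳 ^ 2 - 204930 * 𝐱 * 𝐲 ^ 2 * 𝐳 ^ 2 + 214500 * 𝐱 * 𝐲 * 𝐳 ^ 3 -
      1471250 * 𝐱 * 𝐳 ^ 4 - 7290 * 𝐲 ^ 2 * 𝐳 ^ 3 - 331812 * 𝐲 * 𝐳 ^ 4 + 671550 * 𝐳 ^ 5,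
    972 * 𝐱 ^ 2 * 𝐲 ^ 2 * 𝐳 + 7722 * 𝐱 * 𝐲 * 𝐳 ^ 3 + 729 * 𝐲 * 𝐳 ^ 4 + 30825 * 𝐳 ^ 5]

theorem isHomogeneous_syzF1₁ : ∀ i, (syzF1₁ i).IsHomogeneous 5 := by
  apply forall_vec_isHomogeneous
  all_goals
    repeat' first | apply IsHomogeneous.add | apply IsHomogeneous.sub
  all_goals
    apply isHomogeneous_of_eq
    · repeat' first
        | exact isHomogeneous_X_pow _ _ | exact isHomogeneous_X _ _ | exact isHomogeneous_ofNat _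
        | apply IsHomogeneous.mul | apply IsHomogeneous.neg
    · rfl

/-- A syzygy of degree `6` of `z f₁`. -/
def syzF1₂ : Fin 3 → S3 :=
  ![1188 * 𝐱 ^ 4 * 𝐲 ^ 2 + 27500 * 𝐱 ^ 4 * 𝐲 * 𝐳 - 5874 * 𝐱 ^ 3 * 𝐲 * 𝐳 ^ 2 +
      27500 * 𝐱 ^ 3 * 𝐳 ^ 3 + 2232 * 𝐱 ^ 2 * 𝐲 * 𝐳 ^ 3 + 8613 * 𝐱 ^ 2 * 𝐳 ^ 4 + 48 * 𝐱 * 𝐳 ^ 5 +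
      396 * 𝐳 ^ 6,
    -1782 * 𝐱 ^ 3 * 𝐲 ^ 3 - 41250 * 𝐱 ^ 3 * 𝐲 ^ 2 * 𝐳 + 8217 * 𝐱 ^ 2 * 𝐲 ^ 2 * 𝐳 ^ 2 -
      55000 * 𝐱 ^ 2 * 𝐲 * 𝐳 ^ 3 - 2916 * 𝐱 * 𝐲 ^ 2 * 𝐳 ^ 3 + 330 * 𝐱 * 𝐲 * 𝐳 ^ 4 -
      13750 * 𝐱 * 𝐳 ^ 5 - 3582 * 𝐲 * 𝐳 ^ 5 + 6006 * 𝐳 ^ 6,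
    54 * 𝐱 * 𝐲 * 𝐳 ^ 4 + 279 * 𝐳 ^ 6]

theorem isHomogeneous_syzF1₂ : ∀ i, (syzF1₂ i).IsHomogeneous 6 := by
  apply forall_vec_isHomogeneous
  all_goals
    repeat' first | apply IsHomogeneous.add | apply IsHomogeneous.sub
  all_goals
    apply isHomogeneous_of_eq
    · repeat' first
        | exact isHomogeneous_X_pow _ _ | exact isHomogeneous_X _ _ | exact isHomogeneous_ofNat _
        | apply IsHomogeneous.mul | apply IsHomogeneous.neg
    · rfl

/-- A syzygy of degree `6` of `z f₁`. -/
def syzF1₃ : Fin 3 → S3 :=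
  ![-600 * 𝐱 ^ 4 * 𝐲 ^ 2 + 34100 * 𝐱 ^ 4 * 𝐲 * 𝐳 - 6150 * 𝐱 ^ 3 * 𝐲 * 𝐳 ^ 2 +
      34100 * 𝐱 ^ 3 * 𝐳 ^ 3 - 384 * 𝐱 ^ 2 * 𝐲 * 𝐳 ^ 3 + 11775 * 𝐱 ^ 2 * 𝐳 ^ 4 + 816 * 𝐱 * 𝐳 ^ 5,
    918 * 𝐱 ^ 3 * 𝐲 ^ 3 - 51150 * 𝐱 ^ 3 * 𝐲 ^ 2 * 𝐳 + 9723 * 𝐱 ^ 2 * 𝐲 ^ 2 * 𝐳 ^ 2 -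
      68200 * 𝐱 ^ 2 * 𝐲 * 𝐳 ^ 3 + 540 * 𝐱 * 𝐲 ^ 2 * 𝐳 ^ 3 - 1458 * 𝐱 * 𝐲 * 𝐳 ^ 4 -
      17050 * 𝐱 * 𝐳 ^ 5 - 3210 * 𝐲 * 𝐳 ^ 5 + 7062 * 𝐳 ^ 6,
    -72 * 𝐱 ^ 3 * 𝐲 ^ 2 * 𝐳 - 144 * 𝐱 ^ 2 * 𝐲 * 𝐳 ^ 3 - 54 * 𝐱 * 𝐲 * 𝐳 ^ 4 - 72 * 𝐱 * 𝐳 ^ 5 +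
      321 * 𝐳 ^ 6]

theorem isHomogeneous_syzF1₃ : ∀ i, (syzF1₃ i).IsHomogeneous 6 := by
  apply forall_vec_isHomogeneous
  all_goals
    repeat' first | apply IsHomogeneous.add | apply IsHomogeneous.sub
  all_goals
    apply isHomogeneous_of_eq
    · repeat' first
        | exact isHomogeneous_X_pow _ _ | exact isHomogeneous_X _ _ | exact isHomogeneous_ofNat _
        | apply IsHomogeneous.mul | apply IsHomogeneous.neg
    · rfl

/-- The quadratic coefficient of the relation between the syzygies of `z f₁`. -/
def relF1 : S3 := 54 * 𝐱 * 𝐲 + 1250 * 𝐱 * 𝐳 - 321 * 𝐳 ^ 2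

theorem isHomogeneous_relF1 : relF1.IsHomogeneous 2 := by
  unfold relF1
  repeat' first | apply IsHomogeneous.add | apply IsHomogeneous.sub
  all_goals
    apply isHomogeneous_of_eq
    · repeat' first
        | exact isHomogeneous_X_pow _ _ | exact isHomogeneous_X _ _ | exact isHomogeneous_ofNat _
        | apply IsHomogeneous.mul
    · rfl

theorem linForm_zero_relF1 : linForm 0 (-133750) 16050 = -133750 * 𝐱 + 16050 * 𝐳 := by
  rw [linForm, C_neg, map_ofNat C, map_ofNat C]

theorem linForm_one_relF1 : linForm 1 729 16875 = 729 * 𝐲 + 16875 * 𝐳 := by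
  rw [linForm, map_ofNat C, map_ofNat C]

theorem nearlyFreeData_syzF1 : NearlyFreeData (𝐳 * pencil (-1)) 5 5 syzF1₁ syzF1₂ syzF1₃
    relF1 (-133750) 16050 729 16875 396 where
  prim := isPrimitiveAlongZ_grad_X_two_mul_pencil _
  hom₁ := isHomogeneous_syzF1₁
  hom₂ := isHomogeneous_syzF1₂
  hom₃ := isHomogeneous_syzF1₃
  homq := isHomogeneous_relF1
  deg := rfl
  ha₂ := by norm_num
  ha₃ := by norm_num
  hc := by norm_num
  hq := by
    simp [relF1]
    norm_num
  rel := by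
    rw [linForm_zero_relF1, linForm_one_relF1]
    funext i
    fin_cases i
    all_goals
      simp [relF1, syzF1₁, syzF1₂, syzF1₃]
      ring
  cross₁₂ := by
    rw [grad_X_two_mul_pencil, linForm_one_relF1, map_ofNat C 396, C_neg, C_1]
    apply cross_vec_eq_smul
    · linear_combination -(729 * 𝐲 + 16875 * 𝐳) * 132 * 𝐳 * three_mul_pderiv_zero_f0
    · linear_combination -(729 * 𝐲 + 16875 * 𝐳) * 132 * 𝐳 * three_mul_pderiv_one_f0
    · linear_combination -(729 * 𝐲 + 16875 * 𝐳) * 132 * (three_mul_f0 + 𝐳 * three_mul_pderiv_two_f0)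

/-! ### The curves `f₀ f_b = 0` and `z f₀ f_b = 0` -/

theorem nine_mul_fb : 9 * fb = 9 * f0 + 16 * 𝐳 ^ 10 := by
  rw [fb]
  linear_combination 𝐳 ^ 10 * nine_mul_C

theorem isHomogeneous_fb : fb.IsHomogeneous 10 := isHomogeneous_pencil _

theorem grad_f0_mul_fb : grad (f0 * fb) =
    ![(f0 + fb) * pderiv 0 f0, (f0 + fb) * pderiv 1 f0,
      (f0 + fb) * pderiv 2 f0 + 10 * C (16 / 9) * 𝐳 ^ 9 * f0] := by
  funext i
  fin_cases i
  all_goals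
    simp [grad, fb]
    ring

theorem grad_X_two_mul_f0_mul_fb : grad (𝐳 * (f0 * fb)) =
    ![𝐳 * ((f0 + fb) * pderiv 0 f0), 𝐳 * ((f0 + fb) * pderiv 1 f0),
      f0 * fb + 𝐳 * ((f0 + fb) * pderiv 2 f0 + 10 * C (16 / 9) * 𝐳 ^ 9 * f0)] := by
  funext i
  fin_cases i
  all_goals
    simp [grad, fb]
    ring

theorem isPrimitiveAlongZ_grad_f0_mul_fb : IsPrimitiveAlongZ (grad (f0 * fb)) := by
  rw [grad_f0_mul_fb]
  refine ⟨⟨34, mem_ideal_of_C_mul_mem (by norm_num : (5 * (16 / 9) ^ 2 : ℂ) ≠ 0) ?_⟩, 0,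
    not_X_two_dvd_of_eval_ne_zero (by simp [f0, fb, pderiv_ofNat])⟩
  rw [Ideal.mem_span_range_iff_exists_fun]
  refine ⟨![5 * (f0 + fb) *
      (4 * 𝐱 ^ 4 * 𝐲 + 4 * 𝐱 ^ 3 * 𝐳 ^ 2 + 𝐱 ^ 2 * 𝐳 ^ 3) - 𝐳 ^ 14 * 𝐱,
    5 * (f0 + fb) *
      (-6 * 𝐱 ^ 3 * 𝐲 ^ 2 - 8 * 𝐱 ^ 2 * 𝐲 * 𝐳 ^ 2 - 2 * 𝐱 * 𝐳 ^ 4 + 𝐳 ^ 5) - 𝐳 ^ 14 * 𝐲,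
    -𝐳 ^ 15], ?_⟩
  have hfb : fb = f0 + C (16 / 9) * 𝐳 ^ 10 := rfl
  simp only [Fin.sum_univ_three, Matrix.cons_val, C_mul, C_pow, map_ofNat C 5]
  linear_combination -5 * (f0 + fb) ^ 2 * X_two_pow_fourteen_eq -
    𝐳 ^ 14 * (f0 + fb) * euler_f0 +
    5 * 𝐳 ^ 14 * (fb - f0 + C (16 / 9) * 𝐳 ^ 10) * hfb + 10 * 𝐳 ^ 14 * f0 * hfb

theorem isPrimitiveAlongZ_grad_X_two_mul_f0_mul_fb :
    IsPrimitiveAlongZ (grad (𝐳 * (f0 * fb))) := by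
  rw [grad_X_two_mul_f0_mul_fb]
  refine ⟨⟨35, mem_ideal_of_C_mul_mem (by norm_num : (21 * (16 / 9) ^ 2 : ℂ) ≠ 0) ?_⟩, 2,
    not_X_two_dvd_of_eval_ne_zero (by simp [eval_f0, fb])⟩
  rw [Ideal.mem_span_range_iff_exists_fun]
  refine ⟨![21 * (f0 + fb) *
      (4 * 𝐱 ^ 4 * 𝐲 + 4 * 𝐱 ^ 3 * 𝐳 ^ 2 + 𝐱 ^ 2 * 𝐳 ^ 3) - 4 * 𝐳 ^ 14 * 𝐱,
    21 * (f0 + fb) *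
      (-6 * 𝐱 ^ 3 * 𝐲 ^ 2 - 8 * 𝐱 ^ 2 * 𝐲 * 𝐳 ^ 2 - 2 * 𝐱 * 𝐳 ^ 4 + 𝐳 ^ 5) - 4 * 𝐳 ^ 14 * 𝐲,
    -4 * 𝐳 ^ 15], ?_⟩
  have hfb : fb = f0 + C (16 / 9) * 𝐳 ^ 10 := rfl
  simp only [Fin.sum_univ_three, Matrix.cons_val, C_mul, C_pow, map_ofNat C 21]
  linear_combination -21 * 𝐳 * (f0 + fb) ^ 2 * X_two_pow_fourteen_eq -
    4 * 𝐳 ^ 15 * (f0 + fb) * euler_f0 +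
    21 * 𝐳 ^ 15 * (fb - f0 + C (16 / 9) * 𝐳 ^ 10) * hfb + 40 * 𝐳 ^ 15 * f0 * hfb

/-- The coefficient of `∂f₀/∂x` in an expression of `18 f_b ∂f₀/∂z`. -/
def coeffX : S3 :=
  -81 * 𝐱 ^ 5 * 𝐲 ^ 3 * 𝐳 ^ 2 + 181 * 𝐱 ^ 4 * 𝐲 ^ 2 * 𝐳 ^ 4 - 162 * 𝐱 ^ 3 * 𝐲 ^ 2 * 𝐳 ^ 5 +
    605 * 𝐱 ^ 3 * 𝐲 * 𝐳 ^ 6 + 400 * 𝐱 ^ 2 * 𝐲 * 𝐳 ^ 7 + 343 * 𝐱 ^ 2 * 𝐳 ^ 8 - 81 * 𝐱 * 𝐲 * 𝐳 ^ 8 +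
    210 * 𝐱 * 𝐳 ^ 9 + 117 * 𝐳 ^ 10

/-- The coefficient of `∂f₀/∂y` in an expression of `18 f_b ∂f₀/∂z`. -/
def coeffY : S3 :=
  36 * 𝐱 ^ 5 * 𝐲 ^ 4 * 𝐳 + 162 * 𝐱 ^ 4 * 𝐲 ^ 4 * 𝐳 ^ 2 + 144 * 𝐱 ^ 4 * 𝐲 ^ 3 * 𝐳 ^ 3 -
    21 * 𝐱 ^ 3 * 𝐲 ^ 3 * 𝐳 ^ 4 + 216 * 𝐱 ^ 3 * 𝐲 ^ 2 * 𝐳 ^ 5 + 324 * 𝐱 ^ 2 * 𝐲 ^ 3 * 𝐳 ^ 5 -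
    707 * 𝐱 ^ 2 * 𝐲 ^ 2 * 𝐳 ^ 6 + 144 * 𝐱 ^ 2 * 𝐲 * 𝐳 ^ 7 - 252 * 𝐱 * 𝐲 ^ 2 * 𝐳 ^ 7 -
    703 * 𝐱 * 𝐲 * 𝐳 ^ 8 + 36 * 𝐱 * 𝐳 ^ 9 + 162 * 𝐲 ^ 2 * 𝐳 ^ 8 - 288 * 𝐲 * 𝐳 ^ 9 - 179 * 𝐳 ^ 10

theorem isHomogeneous_coeffX : coeffX.IsHomogeneous 10 := by
  unfold coeffX
  repeat' first | apply IsHomogeneous.add | apply IsHomogeneous.sub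
  all_goals
    apply isHomogeneous_of_eq
    · repeat' first
        | exact isHomogeneous_X_pow _ _ | exact isHomogeneous_X _ _ | exact isHomogeneous_ofNat _
        | apply IsHomogeneous.mul | apply IsHomogeneous.neg
    · rfl

theorem isHomogeneous_coeffY : coeffY.IsHomogeneous 10 := by
  unfold coeffY
  repeat' first | apply IsHomogeneous.add | apply IsHomogeneous.sub
  all_goals
    apply isHomogeneous_of_eq
    · repeat' first
        | exact isHomogeneous_X_pow _ _ | exact isHomogeneous_X _ _ | exact isHomogeneous_ofNat _
        | apply IsHomogeneous.mul
    · rfl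

theorem fb_mul_pderiv_two_f0 :
    18 * fb * pderiv 2 f0 = coeffX * pderiv 0 f0 + coeffY * pderiv 1 f0 := by
  apply mul_left_cancel₀ (left_ne_zero_of_mul_eq_one three_mul_C_third)
  rw [coeffX, coeffY]
  linear_combination 6 * pderiv 2 f0 * nine_mul_fb + 18 * pderiv 2 f0 * three_mul_f0 +
    (6 * (
      3 * 𝐱 ^ 6 * 𝐲 ^ 4 + 12 * 𝐱 ^ 5 * 𝐲 ^ 3 * 𝐳 ^ 2 + 9 * 𝐱 ^ 4 * 𝐲 ^ 3 * 𝐳 ^ 3 +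
        18 * 𝐱 ^ 4 * 𝐲 ^ 2 * 𝐳 ^ 4 + 19 * 𝐱 ^ 3 * 𝐲 ^ 2 * 𝐳 ^ 5 + 12 * 𝐱 ^ 3 * 𝐲 * 𝐳 ^ 6 +
        9 * 𝐱 ^ 2 * 𝐲 ^ 2 * 𝐳 ^ 6 + 11 * 𝐱 ^ 2 * 𝐲 * 𝐳 ^ 7 + 3 * 𝐱 ^ 2 * 𝐳 ^ 8 +
        6 * 𝐱 * 𝐲 * 𝐳 ^ 8 + 𝐱 * 𝐳 ^ 9 + 3 * 𝐲 * 𝐳 ^ 9 - 3 * 𝐳 ^ 10) +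
      32 * 𝐳 ^ 10) * three_mul_pderiv_two_f0 -
    (-81 * 𝐱 ^ 5 * 𝐲 ^ 3 * 𝐳 ^ 2 + 181 * 𝐱 ^ 4 * 𝐲 ^ 2 * 𝐳 ^ 4 - 162 * 𝐱 ^ 3 * 𝐲 ^ 2 * 𝐳 ^ 5 +
        605 * 𝐱 ^ 3 * 𝐲 * 𝐳 ^ 6 + 400 * 𝐱 ^ 2 * 𝐲 * 𝐳 ^ 7 + 343 * 𝐱 ^ 2 * 𝐳 ^ 8 -
        81 * 𝐱 * 𝐲 * 𝐳 ^ 8 + 210 * 𝐱 * 𝐳 ^ 9 + 117 * 𝐳 ^ 10) *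
      three_mul_pderiv_zero_f0 -
    (36 * 𝐱 ^ 5 * 𝐲 ^ 4 * 𝐳 + 162 * 𝐱 ^ 4 * 𝐲 ^ 4 * 𝐳 ^ 2 + 144 * 𝐱 ^ 4 * 𝐲 ^ 3 * 𝐳 ^ 3 -
        21 * 𝐱 ^ 3 * 𝐲 ^ 3 * 𝐳 ^ 4 + 216 * 𝐱 ^ 3 * 𝐲 ^ 2 * 𝐳 ^ 5 + 324 * 𝐱 ^ 2 * 𝐲 ^ 3 * 𝐳 ^ 5 -
        707 * 𝐱 ^ 2 * 𝐲 ^ 2 * 𝐳 ^ 6 + 144 * 𝐱 ^ 2 * 𝐲 * 𝐳 ^ 7 - 252 * 𝐱 * 𝐲 ^ 2 * 𝐳 ^ 7 -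
        703 * 𝐱 * 𝐲 * 𝐳 ^ 8 + 36 * 𝐱 * 𝐳 ^ 9 + 162 * 𝐲 ^ 2 * 𝐳 ^ 8 - 288 * 𝐲 * 𝐳 ^ 9 -
        179 * 𝐳 ^ 10) *
      three_mul_pderiv_one_f0

/-- The Hamiltonian syzygy of `f₀`. -/
def syzHam : Fin 3 → S3 := ![pderiv 1 f0, -pderiv 0 f0, 0]

theorem isHomogeneous_syzHam : ∀ i, (syzHam i).IsHomogeneous 9 :=
  forall_vec_isHomogeneous isHomogeneous_f0.pderiv isHomogeneous_f0.pderiv.neg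
    (isHomogeneous_zero _ _ _)

/-- A syzygy of degree `10` of `f₀ f_b`. -/
def syzProd : Fin 3 → S3 :=
  ![16 * 𝐳 ^ 9 * 𝐱 + coeffX, 16 * 𝐳 ^ 9 * 𝐲 + coeffY, -9 * (f0 + fb)]

theorem isHomogeneous_const_mul {p q : S3} {n : ℕ} (hp : p.IsHomogeneous 0)
    (hq : q.IsHomogeneous n) : (p * q).IsHomogeneous n := by
  simpa using hp.mul hq

theorem isHomogeneous_syzProd : ∀ i, (syzProd i).IsHomogeneous 10 := by
  have hz (i : Fin 3) : (16 * 𝐳 ^ 9 * X i).IsHomogeneous 10 :=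
    (isHomogeneous_const_mul (isHomogeneous_ofNat 16) (isHomogeneous_X_pow 2 9)).mul
      (isHomogeneous_X ℂ i)
  exact forall_vec_isHomogeneous ((hz 0).add isHomogeneous_coeffX)
    ((hz 1).add isHomogeneous_coeffY)
    (isHomogeneous_const_mul (isHomogeneous_ofNat 9).neg (isHomogeneous_f0.add isHomogeneous_fb))

theorem cross_syzProd : syzHam ⨯₃ syzProd = (C 9 : S3) • grad (f0 * fb) := by
  rw [grad_f0_mul_fb, map_ofNat C 9]
  apply cross_vec_eq_smul
  · ring
  · ring
  · linear_combination 16 * 𝐳 ^ 9 * euler_f0 - fb_mul_pderiv_two_f0 +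
      pderiv 2 f0 * nine_mul_fb - 10 * 𝐳 ^ 9 * f0 * nine_mul_C

/-- A syzygy of degree `11` of `z f₀ f_b`. -/
def syzProdLine : Fin 3 → S3 :=
  ![𝐳 * (320 * 𝐳 ^ 9 * 𝐱 + 21 * coeffX) + 18 * 𝐱 * fb,
    𝐳 * (320 * 𝐳 ^ 9 * 𝐲 + 21 * coeffY) + 18 * 𝐲 * fb, 𝐳 * (-180 * (f0 + fb))]

theorem isHomogeneous_syzProdLine : ∀ i, (syzProdLine i).IsHomogeneous 11 := by
  have hz (i : Fin 3) : (320 * 𝐳 ^ 9 * X i).IsHomogeneous 10 :=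
    (isHomogeneous_const_mul (isHomogeneous_ofNat 320) (isHomogeneous_X_pow 2 9)).mul
      (isHomogeneous_X ℂ i)
  have hfb (i : Fin 3) : (18 * X i * fb).IsHomogeneous 11 :=
    (isHomogeneous_const_mul (isHomogeneous_ofNat 18) (isHomogeneous_X ℂ i)).mul isHomogeneous_fb
  have hmul {p : S3} (hp : p.IsHomogeneous 10) : (𝐳 * p).IsHomogeneous 11 :=
    (isHomogeneous_X ℂ 2).mul hp
  have h21 := isHomogeneous_ofNat 21
  exact forall_vec_isHomogeneous
    ((hmul ((hz 0).add (isHomogeneous_const_mul h21 isHomogeneous_coeffX))).add (hfb 0))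
    ((hmul ((hz 1).add (isHomogeneous_const_mul h21 isHomogeneous_coeffY))).add (hfb 1))
    (hmul (isHomogeneous_const_mul (isHomogeneous_ofNat 180).neg
      (isHomogeneous_f0.add isHomogeneous_fb)))

theorem cross_syzProdLine :
    syzHam ⨯₃ syzProdLine = (C 180 : S3) • grad (𝐳 * (f0 * fb)) := by
  rw [grad_X_two_mul_f0_mul_fb, map_ofNat C 180]
  apply cross_vec_eq_smul
  · ring
  · ring
  · linear_combination (320 * 𝐳 ^ 10 + 18 * fb) * euler_f0 - 21 * 𝐳 * fb_mul_pderiv_two_f0 +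
      20 * 𝐳 * pderiv 2 f0 * nine_mul_fb - 200 * 𝐳 ^ 10 * f0 * nine_mul_C

theorem isHomogeneous_f0_mul_fb : (f0 * fb).IsHomogeneous 20 :=
  isHomogeneous_f0.mul isHomogeneous_fb

theorem isHomogeneous_X_two_mul_f0_mul_fb : (𝐳 * (f0 * fb)).IsHomogeneous 21 :=
  isHomogeneous_of_eq ((isHomogeneous_X ℂ 2).mul isHomogeneous_f0_mul_fb) rfl

/-- Freeness properties of the arrangements obtained from the curves `C₀, C_b, C₁` and the
line at infinity `L_z : z = 0`: (1) `C₀ ∪ L_z` and `C₁ ∪ L_z` are nearly free with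
exponents `(5,6)` and `τ = 74`; (2) `C_b ∪ L_z` is free with exponents `(4,6)` and
`τ = 76`; (3) `C₀ ∪ C_b` is free with exponents `(9,10)` and `τ = 271`, and
`C₀ ∪ C_b ∪ L_z` is free with exponents `(9,11)` and `τ = 301`. -/
theorem statement9 :
    (IsNearlyFreeWith (X 2 * f0) 11 5 6 ∧ IsTjurina (X 2 * f0) 74) ∧
    (IsNearlyFreeWith (X 2 * f1) 11 5 6 ∧ IsTjurina (X 2 * f1) 74) ∧
    (IsFreeWith (X 2 * fb) 4 6 ∧ IsTjurina (X 2 * fb) 76) ∧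
    (IsFreeWith (f0 * fb) 9 10 ∧ IsTjurina (f0 * fb) 271) ∧
    (IsFreeWith (X 2 * (f0 * fb)) 9 11 ∧ IsTjurina (X 2 * (f0 * fb)) 301) := by
  have hfb := isPrimitiveAlongZ_grad_X_two_mul_pencil (16 / 9)
  have hp := isPrimitiveAlongZ_grad_f0_mul_fb
  have hpl := isPrimitiveAlongZ_grad_X_two_mul_f0_mul_fb
  have genfb := isMinGenSyz_of_cross hfb (by norm_num) (by norm_num)
    isHomogeneous_syzFb₁ isHomogeneous_syzFb₂ cross_syzFb
  have genp := isMinGenSyz_of_cross hp (by norm_num) (by norm_num)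
    isHomogeneous_syzHam isHomogeneous_syzProd cross_syzProd
  have genpl := isMinGenSyz_of_cross hpl (by norm_num) (by norm_num)
    isHomogeneous_syzHam isHomogeneous_syzProdLine cross_syzProdLine
  refine ⟨?_, ?_, ?_, ⟨⟨_, genp⟩, ?_⟩, ⟨⟨_, genpl⟩, ?_⟩⟩
  · rw [f0_eq_pencil]
    exact ⟨⟨rfl, _, nearlyFreeData_syzF0.isMinGenSyz⟩,
      nearlyFreeData_syzF0.isTjurina (isHomogeneous_X_two_mul_pencil _) rfl rfl⟩
  · rw [f1_eq_pencil]
    exact ⟨⟨rfl, _, nearlyFreeData_syzF1.isMinGenSyz⟩,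
      nearlyFreeData_syzF1.isTjurina (isHomogeneous_X_two_mul_pencil _) rfl rfl⟩
  · rw [fb_eq_pencil]
    exact ⟨⟨_, genfb⟩, isTjurina_of_cross hfb (isHomogeneous_X_two_mul_pencil _) (by norm_num)
      genfb cross_syzFb rfl rfl⟩
  · exact isTjurina_of_cross hp isHomogeneous_f0_mul_fb (by norm_num) genp cross_syzProd rfl rfl
  · exact isTjurina_of_cross hpl isHomogeneous_X_two_mul_f0_mul_fb (by norm_num) genpl
      cross_syzProdLine rfl rfl

end
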